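/- arXiv:2106.03554 — 3 statements merged into one kernel-verified Lean document; each statement's English description precedes it below -/
import Mathlib

section
/- Let (N,M) be a marked proper free-choice net having a home cluster. If (N,M) has no conflict-pair, then (N,M) is lucent. -/
open scoped Classical

/-- A Petri net over places `P` and transitions `T`, given by preset and postset
of each transition (this encodes the flow relation `F`). -/
structure PetriNet (P T : Type) where
  pre : T → Finset P
  post : T → Finset P

namespace PetriNet

variable {P T : Type} [DecidableEq P] (N : PetriNet P T)

/-- A transition is enabled if each input place holds at least one token. -/
def enabled (M : P → ℕ) (t : T) : Prop := ∀ p ∈ N.pre t, 1 ≤ M p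

/-- Firing a transition. -/
def fire (M : P → ℕ) (t : T) : P → ℕ :=
  fun p => M p - (if p ∈ N.pre t then 1 else 0) + (if p ∈ N.post t then 1 else 0)

/-- `Fires M σ M'` : the firing sequence σ is enabled in M and leads to M'. -/
inductive Fires : (P → ℕ) → List T → (P → ℕ) → Prop
  | nil (M : P → ℕ) : Fires M [] M
  | cons {M : P → ℕ} {t : T} {σ : List T} {M'' : P → ℕ} :
      N.enabled M t → Fires (N.fire M t) σ M'' → Fires M (t :: σ) M''

/-- Reachability of markings. -/
def Reach (M M' : P → ℕ) : Prop := ∃ σ : List T, N.Fires M σ M'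

/-- The set of transitions enabled in a marking. -/
def en (M : P → ℕ) : Set T := {t | N.enabled M t}

/-- Lucency: reachable markings are determined by their sets of enabled transitions. -/
def Lucent (M : P → ℕ) : Prop :=
  ∀ M1 M2 : P → ℕ, N.Reach M M1 → N.Reach M M2 → N.en M1 = N.en M2 → M1 = M2

/-- Free-choice: presets of any two transitions are equal or disjoint. -/
def FreeChoice : Prop :=
  ∀ t1 t2 : T, N.pre t1 = N.pre t2 ∨ N.pre t1 ∩ N.pre t2 = ∅

/-- Proper: every transition has a nonempty preset and postset. -/
def Proper : Prop := ∀ t : T, (N.pre t).Nonempty ∧ (N.post t).Nonempty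

/-- The directed edge (flow) relation on nodes `P ⊕ T`. -/
def edge : (P ⊕ T) → (P ⊕ T) → Prop
  | Sum.inl p, Sum.inr t => p ∈ N.pre t
  | Sum.inr t, Sum.inl p => p ∈ N.post t
  | _, _ => False

/-- `InCluster x y` : y is in the cluster of x (smallest set containing x closed
under adding output transitions of places and input places of transitions). -/
inductive InCluster : (P ⊕ T) → (P ⊕ T) → Prop
  | refl (x : P ⊕ T) : InCluster x x
  | toTrans {x : P ⊕ T} {p : P} {t : T} :
      InCluster x (Sum.inl p) → p ∈ N.pre t → InCluster x (Sum.inr t)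
  | toPlace {x : P ⊕ T} {t : T} {p : P} :
      InCluster x (Sum.inr t) → p ∈ N.pre t → InCluster x (Sum.inl p)

/-- The cluster of a node. -/
def cluster (x : P ⊕ T) : Set (P ⊕ T) := {y | N.InCluster x y}

/-- A set of nodes is a cluster if it is the cluster of some node. -/
def IsCluster (C : Set (P ⊕ T)) : Prop := ∃ x : P ⊕ T, C = N.cluster x

/-- `Mrk(C)` : one token on each place of `C`, no tokens elsewhere. -/
noncomputable def clusterMrk (C : Set (P ⊕ T)) : P → ℕ :=
  fun p => if Sum.inl p ∈ C then 1 else 0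

/-- A home marking is reachable from every reachable marking. -/
def IsHomeMarking (M MH : P → ℕ) : Prop := ∀ M', N.Reach M M' → N.Reach M' MH

/-- A home cluster is a cluster whose marking `Mrk(C)` is a home marking. -/
def HomeCluster (M : P → ℕ) (C : Set (P ⊕ T)) : Prop :=
  N.IsCluster C ∧ N.IsHomeMarking M (clusterMrk C)

/-- A conflict-pair for `(N,M)`. -/
def ConflictPair (M M1 M2 : P → ℕ) : Prop :=
  N.Reach M M1 ∧ N.Reach M M2 ∧
  (∃ t, N.enabled M1 t) ∧ (∃ t, N.enabled M2 t) ∧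
  (∀ t, ¬ (N.enabled M1 t ∧ N.enabled M2 t)) ∧
  (∀ t, N.enabled M1 t → ∃ p ∈ N.pre t, 1 ≤ M2 p) ∧
  (∀ t, N.enabled M2 t → ∃ p ∈ N.pre t, 1 ≤ M1 p)

/-- A disentangled path `⟨p_1,t_1,p_2,…,t_{n-1},p_n⟩`, given by its lists of
places and transitions: consecutive nodes are connected by the flow relation and
all places lie in pairwise distinct clusters. -/
def IsDisPath (ps : List P) (ts : List T) : Prop :=
  ps.length = ts.length + 1 ∧
  (∀ (i : ℕ) (t : T) (p p' : P), ts[i]? = some t → ps[i]? = some p →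
      ps[i + 1]? = some p' → p ∈ N.pre t ∧ p' ∈ N.post t) ∧
  ps.Pairwise (fun a b => N.cluster (Sum.inl a) ≠ N.cluster (Sum.inl b))

/-- `Exp M σ σ'` : σ' is obtained from σ by repeatedly expediting transitions
(moving the transition at position j to an earlier position i, provided the
prefix of length i followed by that transition is enabled from M and no
transition at positions i..j-1 shares its cluster). -/
inductive Exp (M : P → ℕ) (σ : List T) : List T → Prop
  | refl : Exp M σ σ
  | step {σ' : List T} {i j : ℕ} (h : Exp M σ σ') (hij : i < j) (hj : j < σ'.length)
      (ha : ∃ Mx, N.Fires M (σ'.take i ++ [σ'.get ⟨j, hj⟩]) Mx)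
      (hb : ∀ (k : ℕ) (hk : k < σ'.length), i ≤ k → k < j →
        N.cluster (Sum.inr (σ'.get ⟨k, hk⟩)) ≠ N.cluster (Sum.inr (σ'.get ⟨j, hj⟩))) :
      Exp M σ ((σ'.eraseIdx j).insertIdx i (σ'.get ⟨j, hj⟩))

/-- Liveness: from every reachable marking, every transition can be enabled again. -/
def Live (M : P → ℕ) : Prop :=
  ∀ M', N.Reach M M' → ∀ t : T, ∃ M'', N.Reach M' M'' ∧ N.enabled M'' t

/-- Boundedness. -/
def Bounded (M : P → ℕ) : Prop :=
  ∃ k, ∀ M', N.Reach M M' → ∀ p, M' p ≤ k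

/-- Safety (1-boundedness). -/
def Safe (M : P → ℕ) : Prop := ∀ M', N.Reach M M' → ∀ p, M' p ≤ 1

end PetriNet

namespace PetriNet

section helpers

variable {P T : Type} [DecidableEq P] {N : PetriNet P T}

lemma Fires.trans_step {X Z : P → ℕ} {σ : List T} (h : N.Fires X σ Z) {t : T}
    (ht : N.enabled Z t) : N.Reach X (N.fire Z t) := by
  induction h with
  | nil X => exact ⟨[t], .cons ht (.nil _)⟩
  | cons he _ ih =>
    obtain ⟨ρ, hρ⟩ := ih ht
    exact ⟨_ :: ρ, .cons he hρ⟩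

lemma Reach.step {M X : P → ℕ} (h : N.Reach M X) {t : T} (ht : N.enabled X t) :
    N.Reach M (N.fire X t) := by
  obtain ⟨σ, hσ⟩ := h
  exact hσ.trans_step ht

lemma enabled_congr {X : P → ℕ} {t u : T} (h : N.pre t = N.pre u) (ht : N.enabled X t) :
    N.enabled X u := by
  intro p hp
  exact ht p (h ▸ hp)

lemma enabled_fire_of_disj {X : P → ℕ} {t u : T} (h : N.pre t ∩ N.pre u = ∅)
    (ht : N.enabled X t) : N.enabled (N.fire X u) t := by
  intro p hp
  have h1 := ht p hp
  have h2 : p ∉ N.pre u := fun h' => by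
    have : p ∈ N.pre t ∩ N.pre u := Finset.mem_inter.2 ⟨hp, h'⟩
    simp [h] at this
  simp only [fire, h2, if_false]
  omega

lemma fire_comm {X : P → ℕ} {t u : T} (h : N.pre t ∩ N.pre u = ∅)
    (ht : N.enabled X t) (hu : N.enabled X u) :
    N.fire (N.fire X u) t = N.fire (N.fire X t) u := by
  funext p
  have h1 := ht p
  have h2 := hu p
  have h3 : ¬ (p ∈ N.pre t ∧ p ∈ N.pre u) := fun h' => by
    have : p ∈ N.pre t ∩ N.pre u := Finset.mem_inter.2 h'
    simp [h] at this
  simp only [fire]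
  by_cases a : p ∈ N.pre t <;> by_cases b : p ∈ N.pre u <;>
    simp only [a, b, true_implies, false_implies, not_true, and_true, true_and, if_true,
      if_false] at * <;> omega

lemma expedite (hfc : N.FreeChoice) {X Z : P → ℕ} {σ : List T} (h : N.Fires X σ Z) {t : T}
    (ht : N.enabled X t) (hu : ∃ u ∈ σ, N.pre u = N.pre t) :
    ∃ t' σ', N.pre t' = N.pre t ∧ N.Fires (N.fire X t') σ' Z ∧ σ'.length < σ.length := by
  induction h with
  | nil X => simp at hu
  | @cons X u σ Z he hf ih =>
    by_cases hut : N.pre u = N.pre t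
    · exact ⟨u, σ, hut, hf, by simp⟩
    · have hd : N.pre t ∩ N.pre u = ∅ := (hfc t u).resolve_left (fun h => hut h.symm)
      obtain ⟨v, hv, hvt⟩ := hu
      have hv' : v ∈ σ := by
        rcases List.mem_cons.1 hv with rfl | h
        · exact absurd hvt hut
        · exact h
      obtain ⟨t', σ', h1, h2, h3⟩ := ih (enabled_fire_of_disj hd ht) ⟨v, hv', hvt⟩
      have ht' : N.enabled X t' := enabled_congr h1.symm ht
      have hd' : N.pre t' ∩ N.pre u = ∅ := by rw [h1]; exact hd
      refine ⟨t', u :: σ', h1, .cons (enabled_fire_of_disj ?_ he) ?_, by simpa using h3⟩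
      · rw [Finset.inter_comm]; exact hd'
      · rw [← fire_comm hd' ht' he]; exact h2

/-- Tokens on the preset of a cluster that is never fired remain. -/
lemma keep (hfc : N.FreeChoice) {X Z : P → ℕ} {σ : List T} (h : N.Fires X σ Z) {t : T}
    (ht : N.enabled X t) (hu : ¬ ∃ u ∈ σ, N.pre u = N.pre t) : N.enabled Z t := by
  induction h with
  | nil X => exact ht
  | @cons X u σ Z he hf ih =>
    have hut : N.pre u ≠ N.pre t := fun h => hu ⟨u, by simp, h⟩
    have hd : N.pre t ∩ N.pre u = ∅ := (hfc t u).resolve_left (fun h => hut h.symm)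
    refine ih (enabled_fire_of_disj hd ht) ?_
    rintro ⟨v, hv, h⟩
    exact hu ⟨v, by simp [hv], h⟩

lemma dead_eq {X Z : P → ℕ} (h : N.Reach X Z) (hd : ∀ t, ¬ N.enabled X t) : X = Z := by
  obtain ⟨σ, hσ⟩ := h
  cases hσ with
  | nil => rfl
  | cons he _ => exact absurd he (hd _)

/-- Facts about the cluster `C` used below. -/
structure CF (N : PetriNet P T) (C : Set (P ⊕ T)) : Prop where
  toT : ∀ p t, Sum.inl p ∈ C → p ∈ N.pre t → Sum.inr t ∈ C
  toP : ∀ p t, Sum.inr t ∈ C → p ∈ N.pre t → Sum.inl p ∈ C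
  all : ∀ p t, Sum.inr t ∈ C → Sum.inl p ∈ C → p ∈ N.pre t
  one : (∀ t, Sum.inr t ∉ C) → ∀ p q, Sum.inl p ∈ C → Sum.inl q ∈ C → p = q

lemma inCluster_inr (hfc : N.FreeChoice) {t0 : T} {y : P ⊕ T} (h : N.InCluster (Sum.inr t0) y) :
    (∀ p, y = Sum.inl p → p ∈ N.pre t0) ∧ (∀ t, y = Sum.inr t → N.pre t = N.pre t0) := by
  induction h with
  | refl => simp
  | @toTrans p t h hp ih =>
    have h1 := ih.1 p rfl
    refine ⟨by simp, ?_⟩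
    rintro _ ⟨⟩
    refine (hfc t t0).resolve_right fun h' => ?_
    have : p ∈ N.pre t ∩ N.pre t0 := Finset.mem_inter.2 ⟨hp, h1⟩
    simp [h'] at this
  | @toPlace t p h hp ih =>
    have h1 := ih.2 t rfl
    refine ⟨?_, by simp⟩
    rintro _ ⟨⟩
    exact h1 ▸ hp

lemma inCluster_inl (hfc : N.FreeChoice) {p0 : P} {y : P ⊕ T} (h : N.InCluster (Sum.inl p0) y) :
    (∀ p, y = Sum.inl p → p = p0 ∨ ∃ t, p0 ∈ N.pre t ∧ p ∈ N.pre t ∧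
      N.InCluster (Sum.inl p0) (Sum.inr t)) ∧
    (∀ t, y = Sum.inr t → p0 ∈ N.pre t) := by
  induction h with
  | refl => simp
  | @toTrans p t h hp ih =>
    have h1 := ih.1 p rfl
    refine ⟨by simp, ?_⟩
    rintro _ ⟨⟩
    rcases h1 with rfl | ⟨u, hu, hu', _⟩
    · exact hp
    · have : N.pre t = N.pre u := (hfc t u).resolve_right fun h' => by
        have : p ∈ N.pre t ∩ N.pre u := Finset.mem_inter.2 ⟨hp, hu'⟩
        simp [h'] at this
      exact this ▸ hu
  | @toPlace t p h hp ih =>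
    have h1 := ih.2 t rfl
    refine ⟨?_, by simp⟩
    rintro _ ⟨⟩
    exact .inr ⟨t, h1, hp, h⟩

lemma pre_eq_of_mem (hfc : N.FreeChoice) {p : P} {t u : T} (h1 : p ∈ N.pre t)
    (h2 : p ∈ N.pre u) : N.pre t = N.pre u :=
  (hfc t u).resolve_right fun h' => by
    have : p ∈ N.pre t ∩ N.pre u := Finset.mem_inter.2 ⟨h1, h2⟩
    simp [h'] at this

lemma cf_of_cluster (hfc : N.FreeChoice) {C : Set (P ⊕ T)} (hC : N.IsCluster C) : CF N C := by
  obtain ⟨x, rfl⟩ := hC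
  refine ⟨fun p t h hp => .toTrans h hp, fun p t h hp => .toPlace h hp, ?_, ?_⟩
  · intro p t ht hp
    cases x with
    | inr t0 =>
      have h1 := (inCluster_inr hfc ht).2 t rfl
      have h2 := (inCluster_inr hfc hp).1 p rfl
      exact h1 ▸ h2
    | inl p0 =>
      have h1 := (inCluster_inl hfc ht).2 t rfl
      rcases (inCluster_inl hfc hp).1 p rfl with rfl | ⟨u, hu, hu', _⟩
      · exact h1
      · exact pre_eq_of_mem hfc hu h1 ▸ hu'
  · intro hno p q hp hq
    cases x with
    | inr t0 => exact absurd (.refl _) (hno t0)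
    | inl p0 =>
      rcases (inCluster_inl hfc hp).1 p rfl with rfl | ⟨u, _, _, hu⟩
      · rcases (inCluster_inl hfc hq).1 q rfl with rfl | ⟨u, _, _, hu⟩
        · rfl
        · exact absurd hu (hno u)
      · exact absurd hu (hno u)

variable {C : Set (P ⊕ T)}

lemma mrk_pos {p : P} (h : 1 ≤ clusterMrk C p) : Sum.inl p ∈ C := by
  unfold clusterMrk at h
  split_ifs at h with h'
  · exact h'
  · omega

lemma mrk_mem {p : P} (h : Sum.inl p ∈ C) : clusterMrk C p = 1 := by simp [clusterMrk, h]

lemma mrk_not {p : P} (h : Sum.inl p ∉ C) : clusterMrk C p = 0 := by simp [clusterMrk, h]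

lemma mrk_enabled (hC : CF N C) {t : T} (ht : Sum.inr t ∈ C) : N.enabled (clusterMrk C) t :=
  fun p hp => (mrk_mem (hC.toP p t ht hp)).ge

lemma mem_of_mrk_enabled (hp : N.Proper) (hC : CF N C) {t : T}
    (ht : N.enabled (clusterMrk C) t) : Sum.inr t ∈ C := by
  obtain ⟨p, hpt⟩ := (hp t).1
  exact hC.toT p t (mrk_pos (ht p hpt)) hpt

lemma mrk_le (hC : CF N C) {t : T} (ht : Sum.inr t ∈ C) {X : P → ℕ} (he : N.enabled X t) :
    ∀ p, clusterMrk C p ≤ X p := by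
  intro p
  by_cases h : Sum.inl p ∈ C
  · rw [mrk_mem h]; exact he p (hC.all p t ht h)
  · rw [mrk_not h]; omega

lemma cfree_eq (hp : N.Proper) (hC : CF N C) {X Z : P → ℕ} {σ : List T} (h : N.Fires X σ Z)
    (hZ : Z = clusterMrk C) (hle : ∀ p, clusterMrk C p ≤ X p)
    (hfree : ∀ u ∈ σ, Sum.inr u ∉ C) : X = clusterMrk C := by
  induction h with
  | nil X => exact hZ
  | @cons X u σ Z he hf ih =>
    exfalso
    have hu : Sum.inr u ∉ C := hfree u (by simp)
    have hnp : ∀ p, Sum.inl p ∈ C → p ∉ N.pre u := fun p h h' => hu (hC.toT p u h h')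
    have h1 : N.fire X u = clusterMrk C := by
      refine ih hZ ?_ (fun v hv => hfree v (by simp [hv]))
      intro p
      by_cases h : Sum.inl p ∈ C
      · have := hle p
        simp only [fire, hnp p h, if_false]
        omega
      · rw [mrk_not h]; omega
    obtain ⟨p, hpp⟩ := (hp u).2
    have h2 := congrFun h1 p
    by_cases h : Sum.inl p ∈ C
    · have := hle p
      simp only [fire, hnp p h, hpp, if_false, if_true] at h2
      omega
    · rw [mrk_not h] at h2
      simp only [fire, hpp, if_true] at h2
      omega

/-- Claim A: reachable markings are pairwise incomparable. -/
lemma incomp {M : P → ℕ} (hp : N.Proper) (hfc : N.FreeChoice) (hC : CF N C)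
    (hh : N.IsHomeMarking M (clusterMrk C)) (n : ℕ) :
    ∀ (X Y : P → ℕ) (σ : List T), σ.length = n → N.Reach M X → N.Reach M Y →
      N.Fires X σ (clusterMrk C) → (∀ p, Y p ≤ X p) → X = Y := by
  induction n using Nat.strong_induction_on with
  | _ n ih =>
  intro X Y σ hn hX hY hσ hle
  by_cases hex : ∃ t, N.enabled Y t ∧ ∃ u ∈ σ, N.pre u = N.pre t
  · obtain ⟨t, hYt, hu⟩ := hex
    have hXt : N.enabled X t := fun p hp => (hYt p hp).trans (hle p)
    obtain ⟨t', σ', h1, h2, h3⟩ := expedite hfc hσ hXt hu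
    have hXt' := enabled_congr h1.symm hXt
    have hYt' := enabled_congr h1.symm hYt
    have := ih σ'.length (by omega) _ (N.fire Y t') σ' rfl (hX.step hXt') (hY.step hYt') h2 (by
      intro p; have := hle p; simp only [fire]; omega)
    funext p
    have h4 := congrFun this p
    have h5 := hXt' p
    have h6 := hYt' p
    simp only [fire] at h4
    by_cases a : p ∈ N.pre t' <;>
      simp only [a, true_implies, false_implies, if_true, if_false] at * <;> omega
  · have key : (∀ p, clusterMrk C p ≤ Y p) ∧ ∀ u ∈ σ, Sum.inr u ∉ C := by
      by_cases hd : ∃ t, N.enabled Y t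
      · obtain ⟨t, ht⟩ := hd
        have hno : ¬ ∃ u ∈ σ, N.pre u = N.pre t := fun h => hex ⟨t, ht, h⟩
        have hXt : N.enabled X t := fun p hp => (ht p hp).trans (hle p)
        have htC := mem_of_mrk_enabled hp hC (keep hfc hσ hXt hno)
        refine ⟨mrk_le hC htC ht, fun u hu huC => hno ⟨u, hu, ?_⟩⟩
        ext p
        exact ⟨fun h => hC.all p t htC (hC.toP p u huC h),
          fun h => hC.all p u huC (hC.toP p t htC h)⟩
      · push Not at hd
        have hYH := dead_eq (hh Y hY) hd
        refine ⟨fun p => by rw [hYH], fun u _ huC => hd u ?_⟩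
        rw [hYH]; exact mrk_enabled hC huC
    have hXH := cfree_eq hp hC hσ rfl (fun p => (key.1 p).trans (hle p)) key.2
    funext p
    have h1 := key.1 p
    have h2 := hle p
    rw [hXH] at h2 ⊢
    omega

lemma eq_home {M : P → ℕ} (hp : N.Proper) (hfc : N.FreeChoice) (hC : CF N C)
    (hh : N.IsHomeMarking M (clusterMrk C)) {X : P → ℕ} (hX : N.Reach M X)
    (hle : ∀ p, clusterMrk C p ≤ X p) : X = clusterMrk C := by
  obtain ⟨σ, hσ⟩ := hh X hX
  exact incomp hp hfc hC hh _ X _ σ rfl hX (hh M ⟨[], .nil _⟩) hσ hle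

/-- Chains of a given length from a place to `C`. -/
def Ch (N : PetriNet P T) (C : Set (P ⊕ T)) : ℕ → P → Prop
  | 0, p => Sum.inl p ∈ C
  | n + 1, p => ∃ t, p ∈ N.pre t ∧ ∃ q ∈ N.post t, Ch N C n q

/-- Shortest chain length. -/
def Dm (N : PetriNet P T) (C : Set (P ⊕ T)) (n : ℕ) (p : P) : Prop :=
  Ch N C n p ∧ ∀ m < n, ¬ Ch N C m p

lemma exists_ch (hp : N.Proper) {X Z : P → ℕ} {σ : List T} (h : N.Fires X σ Z)
    (hZ : Z = clusterMrk C) (q : P) (hq : 1 ≤ X q) : ∃ n, Ch N C n q := by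
  induction h generalizing q with
  | nil X => subst hZ; exact ⟨0, mrk_pos hq⟩
  | @cons X u σ Z he hf ih =>
    by_cases h : q ∈ N.pre u
    · obtain ⟨r, hr⟩ := (hp u).2
      obtain ⟨n, hn⟩ := ih hZ r (by simp only [fire, hr, if_true]; omega)
      exact ⟨n + 1, u, h, r, hr, hn⟩
    · exact ih hZ q (by simp only [fire, h, if_false]; omega)

lemma exists_path (n : ℕ) : ∀ q, Dm N C n q → ∃ g : ℕ → P, g n = q ∧
    (∀ i ≤ n, Dm N C i (g i)) ∧
    ∀ i < n, ∃ t, g (i + 1) ∈ N.pre t ∧ g i ∈ N.post t := by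
  induction n with
  | zero =>
    intro q hq
    exact ⟨fun _ => q, rfl, fun i hi => by obtain rfl : i = 0 := by omega
                                           exact hq, fun i hi => by omega⟩
  | succ n ih =>
    rintro q hq
    obtain ⟨t, hqt, r, hr, hrn⟩ := hq.1
    have hD : Dm N C n r :=
      ⟨hrn, fun m hm h => hq.2 (m + 1) (by omega) ⟨t, hqt, r, hr, h⟩⟩
    obtain ⟨g, h1, h2, h3⟩ := ih r hD
    refine ⟨Function.update g (n + 1) q, by simp, ?_, ?_⟩
    · intro i hi
      rcases Nat.lt_or_ge n i with h | h
      · obtain rfl : i = n + 1 := by omega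
        simpa using hq
      · rw [Function.update_of_ne (by omega)]; exact h2 i h
    · intro i hi
      rcases Nat.lt_or_ge i n with h | h
      · rw [Function.update_of_ne (by omega), Function.update_of_ne (by omega)]
        exact h3 i h
      · obtain rfl : i = n := by omega
        rw [Function.update_self, Function.update_of_ne (by omega), h1]
        exact ⟨t, hqt, hr⟩

lemma dm_same (hfc : N.FreeChoice) (hC : CF N C) {u : T} {a b : P} {i j : ℕ}
    (ha : a ∈ N.pre u) (hb : b ∈ N.pre u) (hi : Dm N C i a) (hj : Dm N C j b) : i = j := by
  have key : ∀ {a b : P} {i : ℕ}, a ∈ N.pre u → b ∈ N.pre u → Ch N C i a → Ch N C i b := by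
    intro a b i ha hb h
    cases i with
    | zero => exact hC.toP b u (hC.toT a u h ha) hb
    | succ i =>
      obtain ⟨t, hat, r⟩ := h
      exact ⟨t, pre_eq_of_mem hfc ha hat ▸ hb, r⟩
  have h1 := key ha hb hi.1
  have h2 := key hb ha hj.1
  by_contra hne
  rcases Nat.lt_or_gt_of_ne hne with h | h
  · exact hj.2 i h h1
  · exact hi.2 j h h2

/-- Two tokens tracked along one shortest path. -/
lemma two_tokens {M : P → ℕ} (hp : N.Proper) (hfc : N.FreeChoice) (hC : CF N C)
    (hh : N.IsHomeMarking M (clusterMrk C)) (n : ℕ) (g : ℕ → P)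
    (hg : ∀ i ≤ n, Dm N C i (g i))
    (hs : ∀ i < n, ∃ t, g (i + 1) ∈ N.pre t ∧ g i ∈ N.post t) (s : ℕ) :
    ∀ (i j : ℕ), i + j = s → i ≤ n → j ≤ n → ∀ (σ : List T) (X : P → ℕ), N.Reach M X →
      N.Fires X σ (clusterMrk C) →
      (∀ p, (if p = g i then 1 else 0) + (if p = g j then 1 else 0) ≤ X p) → False := by
  induction s using Nat.strong_induction_on with
  | _ s ihs =>
  intro i j hij hi hj σ
  have base : ¬ ∀ p, (if p = g i then 1 else 0) + (if p = g j then 1 else 0) ≤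
      clusterMrk C p := by
    intro h
    have h1 := h (g i)
    have h2 := h (g j)
    simp only [if_true] at h1 h2
    have c1 : Ch N C 0 (g i) := mrk_pos (by omega)
    have c2 : Ch N C 0 (g j) := mrk_pos (by omega)
    have e1 : i = 0 := by
      by_contra hne; exact (hg i hi).2 0 (by omega) c1
    have e2 : j = 0 := by
      by_contra hne; exact (hg j hj).2 0 (by omega) c2
    subst e1 e2
    rw [mrk_mem c1] at h1
    simp at h1
  induction σ with
  | nil =>
    intro X hX hf hle
    cases hf
    exact base hle
  | cons u σ ih =>
    intro X hX hf hle
    cases hf with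
    | cons he hf =>
    by_cases hu : Sum.inr u ∈ C
    · have := eq_home hp hfc hC hh hX (mrk_le hC hu he)
      subst this
      exact base hle
    -- pushing the token on `g a`
    have push : ∀ a b, a + b = s → a ≤ n → b ≤ n →
        (∀ p, (if p = g a then 1 else 0) + (if p = g b then 1 else 0) ≤ X p) →
        g a ∈ N.pre u → False := by
      intro a b hab ha hb hle hau
      obtain ⟨k, rfl⟩ : ∃ k, a = k + 1 := by
        cases a with
        | zero => exact absurd (hC.toT _ u (hg 0 ha).1 hau) hu
        | succ k => exact ⟨k, rfl⟩
      obtain ⟨t, ht, ht'⟩ := hs k (by omega)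
      have hpre : N.pre u = N.pre t := pre_eq_of_mem hfc hau ht
      have het := enabled_congr hpre he
      have hR := hX.step het
      obtain ⟨ρ, hρ⟩ := hh _ hR
      refine ihs (k + b) (by omega) k b rfl (by omega) hb ρ _ hR hρ ?_
      intro p
      have hk : g k ∉ N.pre t := fun h => by
        have := dm_same hfc hC h ht (hg k (by omega)) (hg (k + 1) ha)
        omega
      have hb' : g b ∈ N.pre t → b = k + 1 := fun h =>
        dm_same hfc hC h ht (hg b hb) (hg (k + 1) ha)
      have h1 := hle p
      simp only [fire]
      by_cases e1 : p = g k
      · subst e1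
        simp only [hk, ht', if_true, if_false]
        split_ifs at h1 ⊢ <;> omega
      · by_cases e2 : p ∈ N.pre t
        · by_cases e3 : p = g b
          · have := hb' (e3 ▸ e2)
            subst this
            rw [if_pos e3] at h1 ⊢
            rw [if_neg e1, if_pos e2]
            omega
          · simp [e1, e3]
        · simp only [e1, e2, if_false]
          split_ifs at h1 ⊢ <;> omega
    by_cases h1 : g i ∈ N.pre u
    · exact push i j hij hi hj hle h1
    by_cases h2 : g j ∈ N.pre u
    · exact push j i (by omega) hj hi (fun p => by have := hle p; omega) h2
    refine ih _ (hX.step he) hf ?_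
    intro p
    have := hle p
    simp only [fire]
    by_cases e : p ∈ N.pre u
    · have n1 : p ≠ g i := fun h => h1 (h ▸ e)
      have n2 : p ≠ g j := fun h => h2 (h ▸ e)
      simp [n1, n2]
    · simp only [e, if_false]
      omega

lemma safe {M : P → ℕ} (hp : N.Proper) (hfc : N.FreeChoice) (hC : CF N C)
    (hh : N.IsHomeMarking M (clusterMrk C)) : N.Safe M := by
  intro X hX q
  by_contra hq
  obtain ⟨σ, hσ⟩ := hh X hX
  have hex := exists_ch hp hσ rfl q (by omega)
  have hD : Dm N C (Nat.find hex) q := ⟨Nat.find_spec hex, fun m hm => Nat.find_min hex hm⟩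
  obtain ⟨g, h1, h2, h3⟩ := exists_path _ q hD
  refine two_tokens hp hfc hC hh _ g h2 h3 _ _ _ rfl le_rfl le_rfl σ X hX hσ ?_
  intro p
  rw [h1]
  split_ifs with h
  · subst h; omega
  · omega

lemma joint {M : P → ℕ} (hp : N.Proper) (hfc : N.FreeChoice) (hC : CF N C)
    (hh : N.IsHomeMarking M (clusterMrk C)) (hnc : ∀ M1 M2, ¬ N.ConflictPair M M1 M2)
    (D : P → ℤ) (hD1 : ∀ t, ¬ ∀ p ∈ N.pre t, 1 ≤ D p) (hD2 : ∀ t, ¬ ∀ p ∈ N.pre t, D p ≤ -1)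
    (hD0 : (∀ t, Sum.inr t ∉ C) → ∀ p, Sum.inl p ∈ C → D p = 0) (n : ℕ) :
    ∀ (X Y : P → ℕ) (σ : List T), σ.length = n → N.Reach M X → N.Reach M Y →
      N.Fires X σ (clusterMrk C) → (∀ p, (X p : ℤ) - Y p = D p) → X = Y := by
  induction n using Nat.strong_induction_on with
  | _ n ih =>
  intro X Y σ hn hX hY hσ hD
  by_cases hcom : ∃ t, N.enabled X t ∧ N.enabled Y t
  · obtain ⟨t, hXt, hYt⟩ := hcom
    by_cases hu : ∃ u ∈ σ, N.pre u = N.pre t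
    · obtain ⟨t', σ', h1, h2, h3⟩ := expedite hfc hσ hXt hu
      have hXt' := enabled_congr h1.symm hXt
      have hYt' := enabled_congr h1.symm hYt
      have hDD : ∀ p, ((N.fire X t' p : ℕ) : ℤ) - (N.fire Y t' p : ℕ) = D p := by
        intro p
        have h5 := hXt' p
        have h6 := hYt' p
        have h7 := hD p
        simp only [fire]
        by_cases a : p ∈ N.pre t' <;>
          simp only [a, true_implies, false_implies, if_true, if_false] at * <;> omega
      have := ih σ'.length (by omega) _ (N.fire Y t') σ' rfl (hX.step hXt') (hY.step hYt') h2 hDD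
      funext p
      have h4 := congrFun this p
      have h5 := hDD p
      have h6 := hD p
      rw [h4] at h5
      omega
    · have htC := mem_of_mrk_enabled hp hC (keep hfc hσ hXt hu)
      rw [eq_home hp hfc hC hh hX (mrk_le hC htC hXt),
        eq_home hp hfc hC hh hY (mrk_le hC htC hYt)]
  · push Not at hcom
    have deadcase : ∀ {X Y : P → ℕ}, N.Reach M X → N.Reach M Y →
        (∀ p, D p = 0 → X p = Y p) → (∀ t, ¬ N.enabled X t) → X = Y := by
      intro X Y hX hY hD hd
      have hXH := dead_eq (hh X hX) hd
      have hno : ∀ t, Sum.inr t ∉ C := fun t ht => hd t (by rw [hXH]; exact mrk_enabled hC ht)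
      rw [hXH]
      refine (eq_home hp hfc hC hh hY fun p => ?_).symm
      by_cases h : Sum.inl p ∈ C
      · rw [← hD p (hD0 hno p h), hXH]
      · rw [mrk_not h]; omega
    by_cases dX : ∃ t, N.enabled X t
    · by_cases dY : ∃ t, N.enabled Y t
      · exfalso
        refine hnc X Y ⟨hX, hY, dX, dY, fun t h => hcom t h.1 h.2, ?_, ?_⟩
        · intro t ht
          by_contra hno
          push Not at hno
          refine hD1 t fun p hpt => ?_
          have := ht p hpt
          have := hno p hpt
          have := hD p
          omega
        · intro t ht
          by_contra hno
          push Not at hno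
          refine hD2 t fun p hpt => ?_
          have := ht p hpt
          have := hno p hpt
          have := hD p
          omega
      · push Not at dY
        exact (deadcase hY hX (fun p h => by have := hD p; omega) dY).symm
    · push Not at dX
      exact deadcase hX hY (fun p h => by have := hD p; omega) dX

end helpers

end PetriNet

/-- A marked proper free-choice net having a home cluster and no
conflict-pairs is lucent. -/
theorem no_conflict_pairs_implies_lucent {P T : Type} [DecidableEq P]
    (N : PetriNet P T) (M : P → ℕ) (C : Set (P ⊕ T))
    (hp : N.Proper) (hfc : N.FreeChoice) (hc : N.HomeCluster M C)
    (hnc : ∀ M1 M2, ¬ N.ConflictPair M M1 M2) :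
    N.Lucent M := by
  obtain ⟨hcl, hh⟩ := hc
  have hC := PetriNet.cf_of_cluster hfc hcl
  have hsafe := PetriNet.safe hp hfc hC hh
  intro M1 M2 h1 h2 hen
  have hiff : ∀ t, N.enabled M1 t ↔ N.enabled M2 t := fun t => Set.ext_iff.1 hen t
  have home : ∀ {M1 M2 : P → ℕ}, N.Reach M M1 → N.Reach M M2 →
      (∀ t, N.enabled M1 t ↔ N.enabled M2 t) →
      (∀ p, PetriNet.clusterMrk C p ≤ M1 p) → M1 = M2 := by
    intro M1 M2 h1 h2 hiff hle
    have e1 := PetriNet.eq_home hp hfc hC hh h1 hle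
    by_cases hd : ∃ t, N.enabled M1 t
    · obtain ⟨t, ht⟩ := hd
      have htC : Sum.inr t ∈ C := PetriNet.mem_of_mrk_enabled hp hC (e1 ▸ ht)
      rw [e1, PetriNet.eq_home hp hfc hC hh h2 (PetriNet.mrk_le hC htC ((hiff t).1 ht))]
    · push Not at hd
      rw [e1, PetriNet.dead_eq (hh M2 h2) (fun t ht => hd t ((hiff t).2 ht))]
  by_cases c1 : ∀ p, PetriNet.clusterMrk C p ≤ M1 p
  · exact home h1 h2 hiff c1
  by_cases c2 : ∀ p, PetriNet.clusterMrk C p ≤ M2 p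
  · exact (home h2 h1 (fun t => (hiff t).symm) c2).symm
  obtain ⟨σ, hσ⟩ := hh M1 h1
  have zero : (∀ t, Sum.inr t ∉ C) → ∀ X : P → ℕ, (¬ ∀ p, PetriNet.clusterMrk C p ≤ X p) →
      ∀ p, Sum.inl p ∈ C → X p = 0 := by
    intro hno X hX p hpC
    by_contra hne
    refine hX fun q => ?_
    by_cases h : Sum.inl q ∈ C
    · obtain rfl := hC.one hno p q hpC h
      rw [PetriNet.mrk_mem h]; omega
    · rw [PetriNet.mrk_not h]; omega
  refine PetriNet.joint hp hfc hC hh hnc (fun p => (M1 p : ℤ) - M2 p) ?_ ?_ ?_ _ M1 M2 σ rfl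
    h1 h2 hσ (fun _ => rfl)
  · intro t ht
    have e1 : N.enabled M1 t := fun p hpt => by have := ht p hpt; omega
    obtain ⟨p, hpt⟩ := (hp t).1
    have := (hiff t).1 e1 p hpt
    have := ht p hpt
    have := hsafe M1 h1 p
    omega
  · intro t ht
    have e1 : N.enabled M2 t := fun p hpt => by have := ht p hpt; omega
    obtain ⟨p, hpt⟩ := (hp t).1
    have := (hiff t).2 e1 p hpt
    have := ht p hpt
    have := hsafe M2 h2 p
    omega
  · intro hno p hpC
    have := zero hno M1 c1 p hpC
    have := zero hno M2 c2 p hpC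
    simp [*]
end

section
/- A marked proper free-choice net having a home cluster has no conflict-pairs. -/
open scoped Classical

namespace PetriNet

section Aux

variable {P T : Type} [DecidableEq P] {N : PetriNet P T}

theorem aux_append {A B D : P → ℕ} {α β : List T} (h : N.Fires A α B) (h' : N.Fires B β D) :
    N.Fires A (α ++ β) D := by
  induction h with
  | nil => simpa using h'
  | cons he _ ih => exact Fires.cons he (ih h')

theorem aux_split {α β : List T} : ∀ {A D : P → ℕ}, N.Fires A (α ++ β) D →
    ∃ B, N.Fires A α B ∧ N.Fires B β D := by
  induction α with
  | nil => intro A D h; exact ⟨A, Fires.nil A, h⟩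
  | cons t α ih =>
    intro A D h
    cases h with
    | cons he h =>
      obtain ⟨B, h1, h2⟩ := ih h
      exact ⟨B, Fires.cons he h1, h2⟩

theorem aux_reach_trans {A B D : P → ℕ} (h : N.Reach A B) (h' : N.Reach B D) : N.Reach A D := by
  obtain ⟨σ, h⟩ := h
  obtain ⟨τ, h'⟩ := h'
  exact ⟨σ ++ τ, aux_append h h'⟩

theorem aux_reach_fire {A B : P → ℕ} {t : T} (h : N.Reach A B) (he : N.enabled B t) :
    N.Reach A (N.fire B t) :=
  aux_reach_trans h ⟨[t], Fires.cons he (Fires.nil _)⟩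

theorem aux_mono {A B : P → ℕ} {σ : List T} (h : N.Fires A σ B) (p : P)
    (hp : ∀ t ∈ σ, p ∉ N.pre t) : A p ≤ B p := by
  induction h with
  | nil => exact le_rfl
  | cons he _ ih =>
    rename_i A t σ B _
    have h1 := ih (fun u hu => hp u (List.mem_cons_of_mem _ hu))
    have h2 := hp t List.mem_cons_self
    simp only [fire, h2, if_false] at h1
    omega

theorem aux_fire_ge {A : P → ℕ} {t : T} {p : P} (h : p ∉ N.pre t) : A p ≤ N.fire A t p := by
  simp only [fire, h, if_false]; omega

theorem aux_fire_post {A : P → ℕ} {t : T} {p : P} (h : p ∈ N.post t) : 1 ≤ N.fire A t p := by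
  simp only [fire, h, if_true]; omega

theorem aux_first {A B : P → ℕ} {σ : List T} (h : N.Fires A σ B) (Q : T → Prop) :
    (∀ t ∈ σ, ¬ Q t) ∨ ∃ α t D, N.Fires A α D ∧ N.enabled D t ∧ Q t ∧ ∀ u ∈ α, ¬ Q u := by
  induction h with
  | nil => left; simp
  | cons he _ ih =>
    rename_i A t σ B _
    by_cases hq : Q t
    · exact Or.inr ⟨[], t, A, Fires.nil A, he, hq, by simp⟩
    · rcases ih with ih | ⟨α, u, D, h1, h2, h3, h4⟩
      · left
        intro u hu
        rcases List.mem_cons.1 hu with rfl | hu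
        · exact hq
        · exact ih u hu
      · refine Or.inr ⟨t :: α, u, D, Fires.cons he h1, h2, h3, ?_⟩
        intro v hv
        rcases List.mem_cons.1 hv with rfl | hv
        · exact hq
        · exact h4 v hv

theorem aux_list_first (Q : T → Prop) (σ : List T) (h : ∃ t ∈ σ, Q t) :
    ∃ α t β, σ = α ++ t :: β ∧ Q t ∧ ∀ u ∈ α, ¬ Q u := by
  induction σ with
  | nil => simp at h
  | cons t σ ih =>
    by_cases hq : Q t
    · exact ⟨[], t, σ, rfl, hq, by simp⟩
    · obtain ⟨u, hu, hQ⟩ := h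
      rcases List.mem_cons.1 hu with rfl | hu
      · exact absurd hQ hq
      · obtain ⟨α, v, β, rfl, h1, h2⟩ := ih ⟨u, hu, hQ⟩
        refine ⟨t :: α, v, β, rfl, h1, ?_⟩
        intro w hw
        rcases List.mem_cons.1 hw with rfl | hw
        · exact hq
        · exact h2 w hw

theorem aux_fc (hfc : N.FreeChoice) {t u : T} {p : P} (h1 : p ∈ N.pre t) (h2 : p ∈ N.pre u) :
    N.pre t = N.pre u := by
  rcases hfc t u with h | h
  · exact h
  · have : p ∈ N.pre t ∩ N.pre u := Finset.mem_inter.2 ⟨h1, h2⟩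
    rw [h] at this
    simp at this

theorem aux_enabled_congr {A : P → ℕ} {t u : T} (h : N.pre t = N.pre u) (he : N.enabled A t) :
    N.enabled A u := by
  intro p hp
  exact he p (h ▸ hp)

theorem aux_expedite {t : T} {α β : List T} : ∀ {A B : P → ℕ}, N.enabled A t →
    N.Fires A (α ++ t :: β) B → (∀ u ∈ α, ∀ p ∈ N.pre u, p ∉ N.pre t) →
    N.Fires (N.fire A t) (α ++ β) B := by
  induction α with
  | nil =>
    intro A B _ h _
    cases h with
    | cons _ h => exact h
  | cons u α ih =>
    intro A B he h hd
    have hdu := hd u List.mem_cons_self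
    cases h with
    | cons heu h =>
      have het : N.enabled (N.fire A u) t := by
        intro p hp
        exact le_trans (he p hp) (aux_fire_ge (fun h' => hdu p h' hp))
      have h1 := ih het h (fun v hv => hd v (List.mem_cons_of_mem _ hv))
      have heu' : N.enabled (N.fire A t) u := by
        intro p hp
        exact le_trans (heu p hp) (aux_fire_ge (hdu p hp))
      have hcomm : N.fire (N.fire A u) t = N.fire (N.fire A t) u := by
        funext p
        have a1 := he p
        have a2 := heu p
        have a3 := hdu p
        simp only [fire]
        by_cases b1 : p ∈ N.pre t <;> by_cases b2 : p ∈ N.pre u <;> simp [b1, b2] at a1 a2 a3 ⊢ <;>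
          split_ifs <;> omega
      rw [hcomm] at h1
      exact Fires.cons heu' h1

theorem aux_follow (hfc : N.FreeChoice) (X L : P → ℕ) (n : ℕ) : ∀ (K : P → ℕ) (σ : List T),
    σ.length = n → N.Fires (fun p => K p + X p) σ L →
    ∃ K' σ', N.Reach K K' ∧ N.Fires (fun p => K' p + X p) σ' L ∧ ∀ t ∈ σ', ¬ N.enabled K' t := by
  induction n with
  | zero =>
    intro K σ hl h
    have : σ = [] := List.length_eq_zero_iff.1 hl
    subst this
    exact ⟨K, [], ⟨[], Fires.nil K⟩, h, by simp⟩
  | succ n ih =>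
    intro K σ hl h
    by_cases hex : ∃ t ∈ σ, N.enabled K t
    · obtain ⟨α, t, β, rfl, he, hα⟩ := aux_list_first _ σ hex
      have h1 := aux_expedite (A := fun p => K p + X p) (t := t)
        (fun p hp => le_trans (he p hp) (Nat.le_add_right _ _)) h (by
          intro u hu p hp hp'
          exact hα u hu (aux_enabled_congr (aux_fc hfc hp' hp) he))
      have h2 : N.fire (fun p => K p + X p) t = fun p => N.fire K t p + X p := by
        funext p
        have := he p
        simp only [fire]
        by_cases b : p ∈ N.pre t <;> simp [b] at this ⊢ <;> omega
      rw [h2] at h1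
      obtain ⟨K', σ', r1, r2, r3⟩ := ih (N.fire K t) (α ++ β) (by simp at hl ⊢; omega) h1
      exact ⟨K', σ', aux_reach_trans ⟨[t], Fires.cons he (Fires.nil _)⟩ r1, r2, r3⟩
    · exact ⟨K, σ, ⟨[], Fires.nil K⟩, h, fun t ht he => hex ⟨t, ht, he⟩⟩

/-- Places of the same cluster. -/
theorem aux_cluster (hfc : N.FreeChoice) {C : Set (P ⊕ T)} (hC : N.IsCluster C) {t : T} {p q : P}
    (hp : Sum.inl p ∈ C) (hpt : p ∈ N.pre t) : Sum.inl q ∈ C ↔ q ∈ N.pre t := by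
  obtain ⟨x, rfl⟩ := hC
  constructor
  · intro hq
    have key : ∀ y, N.InCluster x y → ∀ s : T, (x = Sum.inr s ∨ ∃ a ∈ N.pre s, x = Sum.inl a) →
        (∀ b, y = Sum.inl b → b ∈ N.pre s) ∧ (∀ u, y = Sum.inr u → N.pre u = N.pre s) := by
      intro y hy
      induction hy with
      | refl =>
        rintro s (rfl | ⟨a, ha, rfl⟩)
        · constructor
          · intro b hb; cases hb
          · intro u hu; cases hu; rfl
        · constructor
          · intro b hb; cases hb; exact ha
          · intro u hu; cases hu
      | toTrans _ hm ih =>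
        intro s hs
        constructor
        · intro b hb; cases hb
        · intro u hu
          cases hu
          exact aux_fc hfc hm ((ih s hs).1 _ rfl)
      | toPlace _ hm ih =>
        intro s hs
        constructor
        · intro b hb
          cases hb
          rw [← (ih s hs).2 _ rfl]; exact hm
        · intro u hu; cases hu
    have hs : ∃ s, (x = Sum.inr s ∨ ∃ a ∈ N.pre s, x = Sum.inl a) := by
      cases hp with
      | refl => exact ⟨t, Or.inr ⟨p, hpt, rfl⟩⟩
      | toPlace h1 hm =>
        rename_i s
        rcases x with a | s'
        · have back : ∀ y, N.InCluster (Sum.inl a) y → (∃ b, y = Sum.inl b ∧ b = a) ∨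
              ∃ s, a ∈ N.pre s := by
            intro y hy
            induction hy with
            | refl => exact Or.inl ⟨a, rfl, rfl⟩
            | toTrans _ hm ih =>
              rcases ih with ⟨b, h1, h2⟩ | h
              · cases h1; subst h2; exact Or.inr ⟨_, hm⟩
              · exact Or.inr h
            | toPlace _ hm ih =>
              rcases ih with ⟨b, h1, h2⟩ | h
              · cases h1
              · exact Or.inr h
          rcases back _ h1 with ⟨b, h2, _⟩ | ⟨s, hs⟩
          · cases h2
          · exact ⟨s, Or.inr ⟨a, hs, rfl⟩⟩
        · exact ⟨s', Or.inl rfl⟩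
    obtain ⟨s, hs⟩ := hs
    have e1 := (key _ hp s hs).1 p rfl
    have e2 := (key _ hq s hs).1 q rfl
    rw [aux_fc hfc hpt e1]; exact e2
  · intro hq
    exact InCluster.toPlace (InCluster.toTrans hp hpt) hq

theorem aux_mrk_one {C : Set (P ⊕ T)} {p : P} (h : Sum.inl p ∈ C) : clusterMrk C p = 1 := by
  simp [clusterMrk, h]

theorem aux_mrk_zero {C : Set (P ⊕ T)} {p : P} (h : Sum.inl p ∉ C) : clusterMrk C p = 0 := by
  simp [clusterMrk, h]

theorem aux_mrk_mem {C : Set (P ⊕ T)} {p : P} (h : 1 ≤ clusterMrk C p) : Sum.inl p ∈ C := by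
  by_contra h'
  rw [aux_mrk_zero h'] at h
  omega

/-- If an enabled transition consumes from `C` then the marking covers `Mrk(C)`. -/
theorem aux_cover (hfc : N.FreeChoice) {C : Set (P ⊕ T)} (hC : N.IsCluster C) {t : T} {p : P}
    (hp : Sum.inl p ∈ C) (hpt : p ∈ N.pre t) {A : P → ℕ} (he : N.enabled A t) :
    ∀ q, clusterMrk C q ≤ A q := by
  intro q
  by_cases hq : Sum.inl q ∈ C
  · rw [aux_mrk_one hq]
    exact he q ((aux_cluster hfc hC hp hpt).1 hq)
  · rw [aux_mrk_zero hq]; omega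

theorem aux_surplus (hp : N.Proper) {C : Set (P ⊕ T)} {A B : P → ℕ} {σ : List T}
    (h : N.Fires A σ B) (hA : ∀ q, clusterMrk C q ≤ A q)
    (hσ : ∀ t ∈ σ, ∀ q ∈ N.pre t, Sum.inl q ∉ C) (hs : ∃ q, clusterMrk C q < A q) :
    ∃ q, clusterMrk C q < B q := by
  induction h with
  | nil => exact hs
  | cons he _ ih =>
    rename_i A t σ B _
    have ht := hσ t List.mem_cons_self
    apply ih
    · intro q
      by_cases hq : Sum.inl q ∈ C
      · exact le_trans (hA q) (aux_fire_ge (fun h' => ht q h' hq))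
      · rw [aux_mrk_zero hq]; omega
    · exact fun u hu => hσ u (List.mem_cons_of_mem _ hu)
    · obtain ⟨q, hq⟩ := (hp t).2
      refine ⟨q, ?_⟩
      by_cases hqC : Sum.inl q ∈ C
      · have h1 : q ∉ N.pre t := fun h' => ht q h' hqC
        have h2 := hA q
        simp only [fire, h1, hq, if_true, if_false]
        omega
      · rw [aux_mrk_zero hqC]
        exact aux_fire_post hq

/-- A reachable marking covering `Mrk(C)` equals `Mrk(C)`. -/
theorem aux_home (hp : N.Proper) (hfc : N.FreeChoice) {M : P → ℕ} {C : Set (P ⊕ T)}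
    (hc : N.HomeCluster M C) {K : P → ℕ} (hK : N.Reach M K) (hcov : ∀ q, clusterMrk C q ≤ K q) :
    ∀ q, K q = clusterMrk C q := by
  by_contra hne
  push Not at hne
  obtain ⟨q, hq⟩ := hne
  have hC := hc.1
  obtain ⟨σ, hσ⟩ := hc.2 K hK
  have hKX : K = fun p => clusterMrk C p + (K p - clusterMrk C p) := by
    funext p; have := hcov p; omega
  have hσ' : N.Fires (fun p => clusterMrk C p + (fun p => K p - clusterMrk C p) p) σ
      (clusterMrk C) := by
    rw [hKX] at hσ; simpa using hσ
  obtain ⟨K', τ, r1, r2, r3⟩ := aux_follow hfc (fun p => K p - clusterMrk C p) (clusterMrk C) _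
    (clusterMrk C) σ rfl hσ'
  have hK' : N.Reach M K' := aux_reach_trans (aux_reach_trans hK ⟨σ, hσ⟩) r1
  have hcov' : ∀ q, clusterMrk C q ≤ K' q := by
    obtain ⟨ρ, hρ⟩ := hc.2 K' hK'
    generalize hL : clusterMrk C = L at hρ
    cases hρ with
    | nil => intro q; exact le_rfl
    | cons he _ =>
      rename_i t ρ' he'
      obtain ⟨a, ha⟩ := (hp t).1
      have h1 := aux_mono r2 a (by
        intro u hu hau
        exact r3 u hu (aux_enabled_congr (aux_fc hfc ha hau) he))
      have h2 := he a ha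
      have haC : Sum.inl a ∈ C := by
        apply aux_mrk_mem
        omega
      subst hL
      exact aux_cover hfc hC haC ha he
  obtain ⟨a, ha⟩ := aux_surplus hp (C := C) r2 (fun a => by have := hcov' a; omega) (by
    intro t ht a hat haC
    apply r3 t ht
    intro b hb
    have := hcov' b
    rwa [aux_mrk_one ((aux_cluster hfc hC haC hat).2 hb)] at this) ⟨q, by
      have h1 := hcov q
      have h2 := hcov' q
      omega⟩
  exact lt_irrefl _ ha

/-- Rooted disentangled paths, as lists of places. -/
inductive AuxRooted (N : PetriNet P T) (C : Set (P ⊕ T)) : List P → Prop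
  | last {p : P} : Sum.inl p ∈ C → AuxRooted N C [p]
  | cons {p : P} {t : T} {p' : P} {l : List P} : p ∈ N.pre t → p' ∈ N.post t →
      (∀ q ∈ p' :: l, q ∉ N.pre t) → AuxRooted N C (p' :: l) → AuxRooted N C (p :: p' :: l)

theorem aux_rooted_end {C : Set (P ⊕ T)} {l : List P} (h : AuxRooted N C l) :
    ∃ q ∈ l, Sum.inl q ∈ C := by
  induction h with
  | last h => exact ⟨_, by simp, h⟩
  | cons _ _ _ _ ih =>
    obtain ⟨q, h1, h2⟩ := ih
    exact ⟨q, List.mem_cons_of_mem _ h1, h2⟩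

theorem aux_rooted_suffix {C : Set (P ⊕ T)} {l : List P} (h : AuxRooted N C l) :
    ∀ {a : P} {s : List P}, a :: s <:+ l → AuxRooted N C (a :: s) := by
  induction h with
  | last h =>
    intro a s hs
    rcases List.suffix_cons_iff.1 hs with h1 | h1
    · rw [h1]; exact AuxRooted.last h
    · simp at h1
  | cons h1 h2 h3 h4 ih =>
    intro a s hs
    rcases List.suffix_cons_iff.1 hs with h5 | h5
    · rw [h5]; exact AuxRooted.cons h1 h2 h3 h4
    · exact ih h5

theorem aux_rooted_swap (hfc : N.FreeChoice) {C : Set (P ⊕ T)} (hC : N.IsCluster C) {p q : P}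
    {s : List P} {t : T} (h : AuxRooted N C (q :: s)) (hq : q ∈ N.pre t) (hp : p ∈ N.pre t) :
    AuxRooted N C (p :: s) := by
  cases h with
  | last h => exact AuxRooted.last ((aux_cluster hfc hC h hq).2 hp)
  | cons h1 h2 h3 h4 =>
    refine AuxRooted.cons ?_ h2 h3 h4
    rw [aux_fc hfc h1 hq]; exact hp

theorem aux_extend (hfc : N.FreeChoice) {C : Set (P ⊕ T)} (hC : N.IsCluster C) {p p' : P}
    {l : List P} {t : T} (h : AuxRooted N C (p' :: l)) (hp : p ∈ N.pre t) (hp' : p' ∈ N.post t) :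
    ∃ s, AuxRooted N C (p :: s) ∧ ∀ m, m ≠ [] → m <:+ p' :: l → (∀ c ∈ m, c ∉ N.pre t) →
      m <:+ s := by
  by_cases hex : ∃ c ∈ p' :: l, c ∈ N.pre t
  · obtain ⟨c, hc, hct⟩ := hex
    obtain ⟨a, b, hab⟩ := List.append_of_mem hc
    have hsuf : c :: b <:+ p' :: l := ⟨a, hab.symm⟩
    refine ⟨b, aux_rooted_swap hfc hC (aux_rooted_suffix h hsuf) hct hp, ?_⟩
    intro m hm hms hmt
    rcases List.suffix_or_suffix_of_suffix hms hsuf with h1 | h1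
    · rcases List.suffix_cons_iff.1 h1 with h2 | h2
      · exact absurd hct (hmt c (by rw [h2]; simp))
      · exact h2
    · exact absurd hct (hmt c (h1.subset (by simp)))
  · refine ⟨p' :: l, AuxRooted.cons hp hp' (fun q hq hqt => hex ⟨q, hq, hqt⟩) h, ?_⟩
    intro m _ hm _
    exact hm

theorem aux_rooted_exists (hpr : N.Proper) (hfc : N.FreeChoice) {C : Set (P ⊕ T)}
    (hC : N.IsCluster C) {A B : P → ℕ} {σ : List T}
    (h : N.Fires A σ B) (hB : B = clusterMrk C) :
    ∀ p, 1 ≤ A p → ∃ l, AuxRooted N C (p :: l) := by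
  induction h with
  | nil =>
    intro p hp
    subst hB
    exact ⟨[], AuxRooted.last (aux_mrk_mem hp)⟩
  | cons he _ ih =>
    rename_i A t σ B _
    intro p hp
    by_cases hpt : p ∈ N.pre t
    · obtain ⟨p', hp'⟩ := (hpr t).2
      obtain ⟨l, hl⟩ := ih hB p' (aux_fire_post hp')
      obtain ⟨s, hs, _⟩ := aux_extend hfc hC hl hpt hp'
      exact ⟨s, hs⟩
    · exact ih hB p (le_trans hp (aux_fire_ge hpt))

/-- Rooted disentangled paths carry at most one token. -/
theorem aux_safe (hpr : N.Proper) (hfc : N.FreeChoice) {M : P → ℕ} {C : Set (P ⊕ T)}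
    (hc : N.HomeCluster M C) {l : List P} (hl : AuxRooted N C l) :
    ∀ K, N.Reach M K → (∀ p ∈ l, K p ≤ 1) ∧
      ∀ p ∈ l, ∀ q ∈ l, p ≠ q → 1 ≤ K p → 1 ≤ K q → False := by
  have hC := hc.1
  induction hl with
  | last h =>
    rename_i p
    intro K hK
    constructor
    · intro p' hp'
      have : p' = p := by simpa using hp'
      subst this
      by_contra h2
      obtain ⟨σ, hσ⟩ := hc.2 K hK
      rcases aux_first hσ (fun t => p' ∈ N.pre t) with h1 | ⟨α, t, D, f1, f2, f3, f4⟩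
      · have := aux_mono hσ p' h1
        rw [aux_mrk_one h] at this
        omega
      · have h3 := aux_mono f1 p' f4
        have h4 := aux_home hpr hfc hc (aux_reach_trans hK ⟨α, f1⟩) (aux_cover hfc hC h f3 f2) p'
        rw [aux_mrk_one h] at h4
        omega
    · intro a ha b hb hab
      simp at ha hb
      exact absurd (ha.trans hb.symm) hab
  | cons h1 h2 h3 h4 ih =>
    rename_i p t p' l
    have hpC : Sum.inl p ∉ C := by
      intro hpC
      obtain ⟨q, hq, hqC⟩ := aux_rooted_end h4
      exact h3 q hq ((aux_cluster hfc hC hpC h1).1 hqC)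
    have hpne : ∀ q ∈ p' :: l, p ≠ q := by
      rintro q hq rfl
      exact h3 _ hq h1
    -- firing `t` while another token lies on the tail is impossible
    have fire_bad : ∀ D u q, N.Reach M D → N.enabled D u → p ∈ N.pre u → q ∈ p' :: l →
        1 ≤ D q → False := by
      intro D u q hD hu hpu hq hDq
      have het : N.enabled D t := aux_enabled_congr (aux_fc hfc hpu h1) hu
      have hr := aux_reach_fire hD het
      have hih := ih (N.fire D t) hr
      have hq1 : 1 ≤ N.fire D t q := le_trans hDq (aux_fire_ge (h3 q hq))
      by_cases hqp : q = p'
      · subst hqp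
        have e := hih.1 q hq
        simp only [fire, h2, h3 q hq, if_true, if_false] at e
        omega
      · exact hih.2 q hq p' (by simp) hqp hq1 (aux_fire_post h2)
    have key : ∀ s, AuxRooted N C s → ∀ q s', s = q :: s' → s <:+ p' :: l → ∀ K, N.Reach M K →
        1 ≤ K p → 1 ≤ K q → False := by
      intro s hs
      induction hs with
      | last hq =>
        rename_i q
        intro q' s' he hsuf K hK hKp hKq
        cases he
        have hqm : q ∈ p' :: l := hsuf.subset (by simp)
        obtain ⟨σ, hσ⟩ := hc.2 K hK
        rcases aux_first hσ (fun u => p ∈ N.pre u ∨ q ∈ N.pre u) with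
          g | ⟨α, u, D, f1, f2, f3, f4⟩
        · have := aux_mono hσ p (fun u hu hh => g u hu (Or.inl hh))
          rw [aux_mrk_zero hpC] at this
          omega
        · have m1 := aux_mono f1 p (fun u hu hh => f4 u hu (Or.inl hh))
          have m2 := aux_mono f1 q (fun u hu hh => f4 u hu (Or.inr hh))
          have hD := aux_reach_trans hK ⟨α, f1⟩
          rcases f3 with f3 | f3
          · exact fire_bad D u q hD f2 f3 hqm (le_trans hKq m2)
          · have := aux_home hpr hfc hc hD (aux_cover hfc hC hq f3 f2) p
            rw [aux_mrk_zero hpC] at this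
            omega
      | cons g1 g2 g3 g4 ihs =>
        rename_i q v q2 s2
        intro q' s' he hsuf K hK hKp hKq
        cases he
        have hqm : q ∈ p' :: l := hsuf.subset (by simp)
        have hpv : p ∉ N.pre v := by
          intro hpv
          apply h3 q hqm
          rw [aux_fc hfc h1 hpv]; exact g1
        obtain ⟨σ, hσ⟩ := hc.2 K hK
        rcases aux_first hσ (fun u => p ∈ N.pre u ∨ q ∈ N.pre u) with
          g | ⟨α, u, D, f1, f2, f3, f4⟩
        · have := aux_mono hσ p (fun u hu hh => g u hu (Or.inl hh))
          rw [aux_mrk_zero hpC] at this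
          omega
        · have m1 := aux_mono f1 p (fun u hu hh => f4 u hu (Or.inl hh))
          have m2 := aux_mono f1 q (fun u hu hh => f4 u hu (Or.inr hh))
          have hD := aux_reach_trans hK ⟨α, f1⟩
          rcases f3 with f3 | f3
          · exact fire_bad D u q hD f2 f3 hqm (le_trans hKq m2)
          · have hev : N.enabled D v := aux_enabled_congr (aux_fc hfc f3 g1) f2
            exact ihs q2 s2 rfl ((List.suffix_cons _ _).trans hsuf) (N.fire D v)
              (aux_reach_fire hD hev)
              (le_trans (le_trans hKp m1) (aux_fire_ge hpv)) (aux_fire_post g2)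
    have pair : ∀ q ∈ p' :: l, ∀ K, N.Reach M K → 1 ≤ K p → 1 ≤ K q → False := by
      intro q hq
      obtain ⟨a, b, hab⟩ := List.append_of_mem hq
      have hsuf : q :: b <:+ p' :: l := ⟨a, hab.symm⟩
      exact key _ (aux_rooted_suffix h4 hsuf) q b rfl hsuf
    intro K hK
    constructor
    · intro a ha
      rcases List.mem_cons.1 ha with rfl | ha
      · by_contra hK2
        obtain ⟨σ, hσ⟩ := hc.2 K hK
        rcases aux_first hσ (fun u => a ∈ N.pre u) with g | ⟨α, u, D, f1, f2, f3, f4⟩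
        · have := aux_mono hσ a g
          rw [aux_mrk_zero hpC] at this
          omega
        · have m1 := aux_mono f1 a f4
          have het : N.enabled D t := aux_enabled_congr (aux_fc hfc f3 h1) f2
          have hr := aux_reach_fire (aux_reach_trans hK ⟨α, f1⟩) het
          refine pair p' (by simp) _ hr ?_ (aux_fire_post h2)
          simp only [fire, h1, if_true]
          omega
      · exact (ih K hK).1 a ha
    · intro a ha b hb hab hKa hKb
      rcases List.mem_cons.1 ha with hap | ha'
      · rcases List.mem_cons.1 hb with hbp | hb'
        · exact hab (hap.trans hbp.symm)
        · rw [hap] at hKa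
          exact pair b hb' K hK hKa hKb
      · rcases List.mem_cons.1 hb with hbp | hb'
        · rw [hbp] at hKb
          exact pair a ha' K hK hKb hKa
        · exact (ih K hK).2 a ha' b hb' hab hKa hKb

/-- Tracing a token back to a transition enabled in the start marking. -/
theorem aux_trace (hfc : N.FreeChoice) {C : Set (P ⊕ T)} (hC : N.IsCluster C) {M2 : P → ℕ}
    (m : List P) (hm : m ≠ []) (α : List T) :
    (∀ α' u D, α' ++ [u] <+: α → N.Fires M2 α' D → N.enabled D u → ∀ c ∈ m, c ∉ N.pre u) →
    ∀ D k s, N.Fires M2 α D → AuxRooted N C (k :: s) → m <:+ k :: s → M2 k = 0 → 1 ≤ D k →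
    ∃ t, N.enabled M2 t ∧ ∀ r ∈ N.pre t, ∃ s, AuxRooted N C (r :: s) ∧ m <:+ s := by
  induction α using List.reverseRecOn with
  | nil =>
    intro _ D k s h _ _ h0 h1
    cases h
    omega
  | append_singleton α u ih =>
    intro hav D k s h hroot hsuf h0 h1
    obtain ⟨B, f1, f2⟩ := aux_split h
    have ih' := ih (fun α' v E hpre => hav α' v E (hpre.trans (List.prefix_append _ _)))
    cases f2 with
    | cons he f2 =>
      cases f2
      have hu := hav α u B (List.prefix_refl _) f1 he
      by_cases hBk : 1 ≤ B k
      · exact ih' B k s f1 hroot hsuf h0 hBk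
      · have hk : k ∈ N.post u := by
          by_contra hk
          simp only [fire, hk, if_false] at h1
          omega
        have ext : ∀ r ∈ N.pre u, ∃ s, AuxRooted N C (r :: s) ∧ m <:+ s := by
          intro r hr
          obtain ⟨s', e1, e2⟩ := aux_extend hfc hC hroot hr hk
          exact ⟨s', e1, e2 m hm hsuf hu⟩
        by_cases heu : N.enabled M2 u
        · exact ⟨u, heu, ext⟩
        · have : ∃ k' ∈ N.pre u, M2 k' = 0 := by
            by_contra hcon
            push Not at hcon
            exact heu (fun a ha => Nat.one_le_iff_ne_zero.2 (hcon a ha))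
          obtain ⟨k', hk', hz⟩ := this
          obtain ⟨s', e1, e2⟩ := ext k' hk'
          exact ih' B k' s' f1 e1 (e2.trans (List.suffix_cons _ _)) hz (he k' hk')

end Aux

end PetriNet

/-- A marked proper free-choice net having a home cluster has no
conflict-pairs. -/
theorem home_cluster_no_conflict_pairs {P T : Type} [DecidableEq P]
    (N : PetriNet P T) (M : P → ℕ) (C : Set (P ⊕ T))
    (hp : N.Proper) (hfc : N.FreeChoice) (hc : N.HomeCluster M C) :
    ∀ M1 M2, ¬ N.ConflictPair M M1 M2 := by
  rintro M1 M2 ⟨hr1, hr2, ⟨t1, ht1⟩, -, hdis, hc1, hc2⟩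
  have hC := hc.1
  obtain ⟨p, hpt, hMp⟩ := hc1 t1 ht1
  have : ∃ q ∈ N.pre t1, M2 q = 0 := by
    by_contra hcon
    push Not at hcon
    exact hdis t1 ⟨ht1, fun a ha => Nat.one_le_iff_ne_zero.2 (hcon a ha)⟩
  obtain ⟨q, hqt, hMq⟩ := this
  obtain ⟨σ, hσ⟩ := hc.2 M2 hr2
  obtain ⟨l, hl⟩ := PetriNet.aux_rooted_exists hp hfc hC hσ rfl p hMp
  have hlq := PetriNet.aux_rooted_swap hfc hC hl hpt hqt
  have hex : ∃ α D, N.Fires M2 α D ∧ 1 ≤ D q ∧ ∀ u ∈ α, p ∉ N.pre u := by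
    rcases PetriNet.aux_first hσ (fun u => p ∈ N.pre u) with g | ⟨α, u, D, f1, f2, f3, f4⟩
    · refine ⟨σ, _, hσ, ?_, g⟩
      have hpC := PetriNet.aux_mrk_mem (le_trans hMp (PetriNet.aux_mono hσ p g))
      rw [PetriNet.aux_mrk_one ((PetriNet.aux_cluster hfc hC hpC hpt).2 hqt)]
    · refine ⟨α, D, f1, f2 q ?_, f4⟩
      rw [PetriNet.aux_fc hfc f3 hpt]; exact hqt
  obtain ⟨α, D, f1, f2, f3⟩ := hex
  obtain ⟨t, ht, hroots⟩ := PetriNet.aux_trace hfc hC (q :: l) (by simp) α (by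
    intro α' u B hpre g1 g2 c hcm hcu
    have hpu : p ∉ N.pre u := f3 u (hpre.subset (by simp))
    rcases List.mem_cons.1 hcm with rfl | hcm
    · apply hpu
      rw [PetriNet.aux_fc hfc hcu hqt]; exact hpt
    · have hBp : 1 ≤ B p := le_trans hMp (PetriNet.aux_mono g1 p
        (fun v hv => f3 v (hpre.subset (by simp [hv]))))
      have hne : p ≠ c := by
        rintro rfl
        exact hpu hcu
      exact (PetriNet.aux_safe hp hfc hc hl B (PetriNet.aux_reach_trans hr2 ⟨α', g1⟩)).2 p
        (by simp) c (by simp [hcm]) hne hBp (g2 c hcu)) D q l f1 hlq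
        (List.suffix_refl _) hMq f2
  obtain ⟨r, hrt, hMr⟩ := hc2 t ht
  obtain ⟨s, hs1, hs2⟩ := hroots r hrt
  have hne : r ≠ q := by
    rintro rfl
    have := ht r hrt
    omega
  exact (PetriNet.aux_safe hp hfc hc hs1 M1 hr1).2 r (by simp) q
    (List.mem_cons_of_mem _ (hs2.subset (by simp))) hne hMr (ht1 q hqt)
end

section
/- Every marked proper free-choice net having a home cluster is lucent: distinct reachable markings enable distinct sets of transitions. -/
open scoped Classical

namespace PetriNet

section Helpers

variable {P T : Type} [DecidableEq P] {N : PetriNet P T}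

/-- Usable form of the free-choice property. -/
def FC (N : PetriNet P T) : Prop :=
  ∀ t1 t2 : T, ∀ p, p ∈ N.pre t1 → p ∈ N.pre t2 → N.pre t1 = N.pre t2

theorem FreeChoice.fc (h : N.FreeChoice) : FC N := by
  intro t1 t2 p h1 h2
  rcases h t1 t2 with h | h
  · exact h
  · exfalso
    have : p ∈ N.pre t1 ∩ N.pre t2 := Finset.mem_inter.2 ⟨h1, h2⟩
    rw [h] at this
    simp at this

theorem fire_ge {M : P → ℕ} {t : T} {p : P} (h : p ∉ N.pre t) : M p ≤ N.fire M t p := by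
  simp [fire, h]

theorem fire_post_ge {M : P → ℕ} {t : T} {p : P} (h : p ∉ N.pre t) (h' : p ∈ N.post t) :
    M p + 1 ≤ N.fire M t p := by
  simp [fire, h, h']

theorem fire_post {M : P → ℕ} {t : T} {p : P} (h' : p ∈ N.post t) :
    1 ≤ N.fire M t p := by
  simp [fire, h']

theorem fire_pred {M : P → ℕ} {t : T} {p : P} : M p ≤ N.fire M t p + 1 := by
  simp only [fire]; split_ifs <;> omega

theorem fire_new {M : P → ℕ} {t : T} {p : P} (h : 1 ≤ N.fire M t p) :
    1 ≤ M p ∨ p ∈ N.post t := by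
  by_contra hc
  push Not at hc
  obtain ⟨h1, h2⟩ := hc
  simp only [fire, h2, if_false] at h
  omega

theorem fire_add {M D : P → ℕ} {t : T} (h : N.enabled M t) :
    N.fire (M + D) t = N.fire M t + D := by
  funext p
  have := h p
  simp only [fire, Pi.add_apply]
  by_cases hp : p ∈ N.pre t
  · have := h p hp
    simp only [hp, if_true]
    omega
  · simp only [hp, if_false]
    omega

theorem enabled_add {M D : P → ℕ} {t : T} (h : N.enabled M t) : N.enabled (M + D) t := by
  intro p hp
  have := h p hp
  simp only [Pi.add_apply]
  omega

theorem fire_comm_s13 {M : P → ℕ} {s t : T} (hs : N.enabled M s) (ht : N.enabled M t)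
    (hd : ∀ p, p ∈ N.pre s → p ∉ N.pre t) :
    N.fire (N.fire M s) t = N.fire (N.fire M t) s := by
  funext p
  have h1 := hs p
  have h2 := ht p
  have h3 := hd p
  simp only [fire]
  by_cases a : p ∈ N.pre s
  · have b := h3 a
    have := h1 a
    simp only [a, b, if_true, if_false]
    omega
  · by_cases b : p ∈ N.pre t
    · have := h2 b
      simp only [a, b, if_true, if_false]
      omega
    · simp only [a, b, if_false]
      omega

theorem enabled_fire {M : P → ℕ} {s t : T} (ht : N.enabled M t)
    (hd : ∀ p, p ∈ N.pre t → p ∉ N.pre s) : N.enabled (N.fire M s) t := by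
  intro p hp
  exact le_trans (ht p hp) (fire_ge (hd p hp))

theorem FC.disj (hf : FC N) {s t : T} (h : N.pre s ≠ N.pre t) :
    ∀ p, p ∈ N.pre s → p ∉ N.pre t := fun p h1 h2 => h (hf s t p h1 h2)

theorem expedite_s13 (hf : FC N) {u : T} {σ : List T} : ∀ {M M' : P → ℕ}, N.enabled M u →
    N.Fires M σ M' → (∃ t ∈ σ, N.pre t = N.pre u) →
    ∃ t σ', N.pre t = N.pre u ∧ N.Fires (N.fire M t) σ' M' ∧ σ'.length + 1 = σ.length := by
  induction σ with
  | nil => rintro M M' _ _ ⟨t, ht, _⟩; simp at ht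
  | cons s σ ih =>
    rintro M M' hu hF hex
    cases hF with
    | cons hs hF =>
    by_cases hsu : N.pre s = N.pre u
    · exact ⟨s, σ, hsu, hF, rfl⟩
    · have hex' : ∃ t ∈ σ, N.pre t = N.pre u := by
        obtain ⟨t, ht, h⟩ := hex
        rcases List.mem_cons.1 ht with rfl | ht
        · exact absurd h hsu
        · exact ⟨t, ht, h⟩
      obtain ⟨t, σ', htu, hF', hl⟩ := ih (enabled_fire hu (hf.disj (Ne.symm hsu))) hF hex'
      have hst : N.pre s ≠ N.pre t := by rw [htu]; exact hsu
      have ht : N.enabled M t := by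
        intro p hp; rw [htu] at hp; exact hu p hp
      refine ⟨t, s :: σ', htu, ?_, by simp [hl]⟩
      refine Fires.cons (enabled_fire hs (hf.disj hst)) ?_
      rw [← fire_comm_s13 hs ht (hf.disj hst)]
      exact hF'

theorem persist (hf : FC N) {u : T} {σ : List T} : ∀ {M M' : P → ℕ}, N.enabled M u →
    N.Fires M σ M' → (¬ ∃ t ∈ σ, N.pre t = N.pre u) → N.enabled M' u := by
  induction σ with
  | nil => rintro M M' hu hF _; cases hF; exact hu
  | cons s σ ih =>
    rintro M M' hu hF hex
    cases hF with
    | cons hs hF =>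
    push Not at hex
    refine ih (enabled_fire hu (hf.disj (Ne.symm (hex s (by simp))))) hF ?_
    push Not
    exact fun t ht => hex t (by simp [ht])

theorem Fires.append {M M' M'' : P → ℕ} {σ τ : List T} (h : N.Fires M σ M')
    (h' : N.Fires M' τ M'') : N.Fires M (σ ++ τ) M'' := by
  induction h with
  | nil => exact h'
  | cons he _ ih => exact Fires.cons he (ih h')

theorem Reach.trans {M M' M'' : P → ℕ} (h : N.Reach M M') (h' : N.Reach M' M'') :
    N.Reach M M'' := by
  obtain ⟨σ, h⟩ := h
  obtain ⟨τ, h'⟩ := h'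
  exact ⟨_, h.append h'⟩

theorem Reach.refl (M : P → ℕ) : N.Reach M M := ⟨[], Fires.nil M⟩

theorem Reach.fire {M M' : P → ℕ} {t : T} (h : N.Reach M M') (ht : N.enabled M' t) :
    N.Reach M (N.fire M' t) :=
  h.trans ⟨[t], Fires.cons ht (Fires.nil _)⟩

/-- `H` is a zero-one marking such that any transition touching it has exactly
the support of `H` as its preset. -/
structure ClMark (N : PetriNet P T) (H : P → ℕ) : Prop where
  le_one : ∀ p, H p ≤ 1
  touch : ∀ t p, p ∈ N.pre t → 1 ≤ H p → ∀ q, 1 ≤ H q ↔ q ∈ N.pre t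

theorem nonzero_fires (hp : N.Proper) {σ : List T} : ∀ {D D' : P → ℕ}, N.Fires D σ D' →
    D ≠ 0 → D' ≠ 0 := by
  induction σ with
  | nil => intro D D' h; cases h; exact id
  | cons s σ ih =>
    intro D D' h _
    cases h with
    | cons hs hF =>
    refine ih hF ?_
    obtain ⟨y, hy⟩ := (hp s).2
    intro h0
    have := fire_post (N := N) (M := D) hy
    rw [h0] at this
    simp at this

/-- If no transition of the sequence touches `H`, then it runs without `H`. -/
theorem fires_cancel {H : P → ℕ} {σ : List T} : ∀ {D M' : P → ℕ}, N.Fires (H + D) σ M' →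
    (∀ t ∈ σ, ∀ p ∈ N.pre t, H p = 0) → ∃ D', N.Fires D σ D' ∧ M' = H + D' := by
  induction σ with
  | nil => intro D M' h _; cases h; exact ⟨D, Fires.nil D, rfl⟩
  | cons s σ ih =>
    intro D M' h h0
    cases h with
    | cons hs hF =>
    have hsD : N.enabled D s := by
      intro p hp
      have h1 := hs p hp
      have h2 := h0 s (by simp) p hp
      simp only [Pi.add_apply] at h1
      omega
    have heq : N.fire (H + D) s = H + N.fire D s := by
      rw [add_comm H D, fire_add hsD, add_comm]
    rw [heq] at hF
    obtain ⟨D', h1, h2⟩ := ih hF (fun t ht => h0 t (by simp [ht]))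
    exact ⟨D', Fires.cons hsD h1, h2⟩

/-- Key fact: nothing strictly above the home cluster marking can reach it. -/
theorem above_home (hp : N.Proper) (hf : FC N) {H : P → ℕ} (hH : ClMark N H)
    (hhome : ∀ M, N.Reach H M → N.Reach M H) :
    ∀ n : ℕ, ∀ (D : P → ℕ) (σ : List T), σ.length = n → N.Fires (H + D) σ H → D = 0 := by
  intro n
  induction n using Nat.strong_induction_on with
  | _ n ih =>
  intro D σ hn hF
  by_contra hD
  have claim : ∀ m : ℕ, m < n → ∀ (Mh : P → ℕ) (σ' : List T), σ'.length = m → N.Reach H Mh →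
      N.Fires (Mh + D) σ' H → False := by
    intro m
    induction m with
    | zero =>
      intro hm Mh σ' hl hR hF'
      obtain ⟨τ, hτ⟩ := hhome Mh hR
      cases hτ with
      | nil => exact hD (ih 0 hm D σ' hl hF')
      | @cons _ u _ _ hu hτ =>
        have hnil : σ' = [] := List.length_eq_zero_iff.1 hl
        have huH : N.enabled H u := persist hf (enabled_add hu) hF' (by simp [hnil])
        obtain ⟨x, hx⟩ := (hp u).1
        have ht := hH.touch u x hx (huH x hx)
        have heq : Mh = H + (Mh - H) := by
          funext q
          simp only [Pi.add_apply, Pi.sub_apply]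
          by_cases hq : q ∈ N.pre u
          · have := hu q hq
            have := hH.le_one q
            omega
          · have : ¬ 1 ≤ H q := fun h => hq ((ht q).1 h)
            omega
        rw [heq, add_assoc] at hF'
        have := ih 0 hm _ σ' hl hF'
        apply hD
        funext q
        have h2 := congrFun this q
        simp only [Pi.add_apply, Pi.zero_apply] at h2 ⊢
        omega
    | succ m ihm =>
      intro hm Mh σ' hl hR hF'
      obtain ⟨τ, hτ⟩ := hhome Mh hR
      cases hτ with
      | nil => exact hD (ih _ hm D σ' hl hF')
      | @cons _ u _ _ hu hτ =>
        by_cases hex : ∃ t ∈ σ', N.pre t = N.pre u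
        · obtain ⟨t, σ'', htu, hF'', hl'⟩ := expedite_s13 hf (enabled_add hu) hF' hex
          have ht : N.enabled Mh t := by
            intro p hp; rw [htu] at hp; exact hu p hp
          rw [fire_add ht] at hF''
          exact ihm (by omega) _ σ'' (by omega) (hR.fire ht) hF''
        · have huH : N.enabled H u := persist hf (enabled_add hu) hF' hex
          obtain ⟨x, hx⟩ := (hp u).1
          have ht := hH.touch u x hx (huH x hx)
          have heq : Mh = H + (Mh - H) := by
            funext q
            simp only [Pi.add_apply, Pi.sub_apply]
            by_cases hq : q ∈ N.pre u
            · have := hu q hq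
              have := hH.le_one q
              omega
            · have : ¬ 1 ≤ H q := fun h => hq ((ht q).1 h)
              omega
          rw [heq, add_assoc] at hF'
          have := ih _ hm _ σ' hl hF'
          apply hD
          funext q
          have h2 := congrFun this q
          simp only [Pi.add_apply, Pi.zero_apply] at h2 ⊢
          omega
  by_cases hex : ∃ u ∈ σ, ∃ p ∈ N.pre u, 1 ≤ H p
  · obtain ⟨u, huσ, p, hpu, hHp⟩ := hex
    have hu : N.enabled H u := fun q hq => (hH.touch u p hpu hHp q).2 hq
    obtain ⟨t, σ', htu, hF', hl⟩ := expedite_s13 hf (enabled_add hu) hF ⟨u, huσ, rfl⟩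
    have ht : N.enabled H t := by
      intro p hp; rw [htu] at hp; exact hu p hp
    rw [fire_add ht] at hF'
    exact claim _ (by omega) _ σ' rfl ((Reach.refl H).fire ht) hF'
  · push Not at hex
    obtain ⟨D', h1, h2⟩ := fires_cancel hF (fun t ht p hp => by have := hex t ht p hp; omega)
    apply nonzero_fires hp h1 hD
    funext q
    have h3 := congrFun h2 q
    simp only [Pi.add_apply, Pi.zero_apply] at h3 ⊢
    omega

/-- The standing situation: from every marking satisfying `R`, `H` is reachable. -/
structure Sit (N : PetriNet P T) (R : (P → ℕ) → Prop) (H : P → ℕ) : Prop where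
  proper : N.Proper
  fc : FC N
  cl : ClMark N H
  step : ∀ M t, R M → N.enabled M t → R (N.fire M t)
  home : ∀ M, R M → N.Reach M H
  above : ∀ M, R M → (∀ p, H p ≤ M p) → M = H

variable {R : (P → ℕ) → Prop} {H : P → ℕ}

/-- An enabled transition touching `H` forces the marking to be `H`. -/
theorem Sit.eq_of_touch (S : Sit N R H) {M : P → ℕ} (hM : R M) {s : T} (hs : N.enabled M s)
    {p : P} (hp : p ∈ N.pre s) (hH : 1 ≤ H p) : M = H := by
  apply S.above M hM
  intro q
  have h1 := S.cl.le_one q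
  by_cases hq : 1 ≤ H q
  · have := hs q ((S.cl.touch s p hp hH q).1 hq)
    omega
  · omega

/-- Disentangled paths ending in the support of `H`. -/
inductive DPath (N : PetriNet P T) (H : P → ℕ) : List P → Prop
  | last {q : P} : 1 ≤ H q → DPath N H [q]
  | cons {p : P} {t : T} {q : P} {l : List P} : p ∈ N.pre t → q ∈ N.post t → H p = 0 →
      (∀ x ∈ q :: l, x ∉ N.pre t) → DPath N H (q :: l) → DPath N H (p :: q :: l)

/-- A marked place outside of `H` can be brought into an enabled cluster. -/
theorem Sit.wait (S : Sit N R H) {p : P} {t : T} {k : ℕ} (hpt : p ∈ N.pre t) (hHp : H p = 0)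
    (hk : 1 ≤ k) {σ : List T} : ∀ {M : P → ℕ}, R M → N.Fires M σ H → k ≤ M p →
    ∃ M', R M' ∧ N.enabled M' t ∧ k ≤ M' p := by
  induction σ with
  | nil => intro M hM hF h; cases hF; omega
  | cons s σ ih =>
    intro M hM hF h
    cases hF with
    | cons hs hF =>
    by_cases hps : p ∈ N.pre s
    · refine ⟨M, hM, ?_, h⟩
      intro x hx
      rw [S.fc t s p hpt hps] at hx
      exact hs x hx
    · exact ih (S.step _ _ hM hs) hF (le_trans h (fire_ge hps))

/-- As `wait`, while keeping a token on a path. -/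
theorem Sit.move (S : Sit N R H) {p : P} {t : T} (hpt : p ∈ N.pre t) (hHp : H p = 0)
    {l : List P} (hl : DPath N H l) : (∀ x ∈ l, x ∉ N.pre t) → ∀ {M : P → ℕ}, R M → 1 ≤ M p →
    ∀ x ∈ l, 1 ≤ M x → ∃ M', R M' ∧ N.enabled M' t ∧ ∃ y ∈ l, 1 ≤ M' y := by
  induction hl with
  | @last q hq =>
    intro hdis M hM hMp x hx hMx
    simp only [List.mem_singleton] at hx
    subst hx
    obtain ⟨σ, hσ⟩ := S.home M hM
    induction σ generalizing M with
    | nil => cases hσ; omega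
    | cons s σ ih =>
      cases hσ with
      | cons hs hF =>
      by_cases hps : p ∈ N.pre s
      · refine ⟨M, hM, ?_, x, by simp, hMx⟩
        intro z hz
        rw [S.fc t s p hpt hps] at hz
        exact hs z hz
      by_cases hxs : x ∈ N.pre s
      · have := S.eq_of_touch hM hs hxs hq
        rw [this] at hMp
        omega
      · exact ih (S.step _ _ hM hs) (le_trans hMp (fire_ge hps)) (le_trans hMx (fire_ge hxs)) hF
  | @cons a t' b l hat hbt hHa hdis' hP ihP =>
    intro hdis M hM hMp x hx hMx
    have lift : ∀ {M : P → ℕ}, R M → 1 ≤ M p → ∀ x ∈ b :: l, 1 ≤ M x →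
        ∃ M', R M' ∧ N.enabled M' t ∧ ∃ y ∈ a :: b :: l, 1 ≤ M' y := by
      intro M hM hMp x hx hMx
      obtain ⟨M', h1, h2, y, hy, h3⟩ :=
        ihP (fun x hx => hdis x (List.mem_cons_of_mem _ hx)) hM hMp x hx hMx
      exact ⟨M', h1, h2, y, List.mem_cons_of_mem _ hy, h3⟩
    rcases List.mem_cons.1 hx with rfl | hx
    · obtain ⟨σ, hσ⟩ := S.home M hM
      induction σ generalizing M with
      | nil => cases hσ; omega
      | cons s σ ih =>
        cases hσ with
        | cons hs hF =>
        by_cases hps : p ∈ N.pre s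
        · refine ⟨M, hM, ?_, x, by simp, hMx⟩
          intro z hz
          rw [S.fc t s p hpt hps] at hz
          exact hs z hz
        by_cases hxs : x ∈ N.pre s
        · have heq := S.fc t' s x hat hxs
          have ht' : N.enabled M t' := by
            intro z hz; rw [heq] at hz; exact hs z hz
          refine lift (S.step _ _ hM ht') ?_ b (by simp) (fire_post hbt)
          refine le_trans hMp (fire_ge ?_)
          rw [heq]; exact hps
        · exact ih (S.step _ _ hM hs) (le_trans hMp (fire_ge hps))
            (le_trans hMx (fire_ge hxs)) hF
    · exact lift hM hMp x hx hMx

theorem sum_pos_of_mem {M : P → ℕ} {l : List P} {x : P} (hx : x ∈ l) (h : 1 ≤ M x) :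
    1 ≤ (l.map M).sum := by
  induction l with
  | nil => simp at hx
  | cons a l ih =>
    simp only [List.map_cons, List.sum_cons]
    rcases List.mem_cons.1 hx with rfl | hx
    · omega
    · have := ih hx
      omega

theorem exists_of_sum_pos {M : P → ℕ} {l : List P} (h : 1 ≤ (l.map M).sum) :
    ∃ x ∈ l, 1 ≤ M x := by
  induction l with
  | nil => simp at h
  | cons a l ih =>
    simp only [List.map_cons, List.sum_cons] at h
    by_cases ha : 1 ≤ M a
    · exact ⟨a, by simp, ha⟩
    · obtain ⟨x, hx, h'⟩ := ih (by omega)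
      exact ⟨x, by simp [hx], h'⟩

theorem sum_fire_ge {M : P → ℕ} {t : T} {l : List P} (h : ∀ x ∈ l, x ∉ N.pre t) :
    (l.map M).sum ≤ (l.map (N.fire M t)).sum := by
  induction l with
  | nil => simp
  | cons a l ih =>
    simp only [List.map_cons, List.sum_cons]
    have h1 := ih (fun x hx => h x (by simp [hx]))
    have h2 : M a ≤ N.fire M t a := fire_ge (h a (by simp))
    omega

/-- Disentangled paths carry at most one token. -/
theorem Sit.path_le_one (S : Sit N R H) {l : List P} (hl : DPath N H l) :
    ∀ {M : P → ℕ}, R M → (l.map M).sum ≤ 1 := by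
  induction hl with
  | @last q hq =>
    intro M hM
    simp only [List.map_cons, List.map_nil, List.sum_cons, List.sum_nil, add_zero]
    by_contra hc
    obtain ⟨σ, hσ⟩ := S.home M hM
    induction σ generalizing M with
    | nil => cases hσ; exact hc (S.cl.le_one q)
    | cons s σ ih =>
      cases hσ with
      | cons hs hF =>
      by_cases hqs : q ∈ N.pre s
      · have := S.eq_of_touch hM hs hqs hq
        rw [this] at hc
        exact hc (S.cl.le_one q)
      · refine ih (S.step _ _ hM hs) ?_ hF
        have : M q ≤ N.fire M s q := fire_ge hqs
        omega
  | @cons p t q l hpt hqt hHp hdis hP ihP =>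
    have key : ∀ {M : P → ℕ}, R M → 1 ≤ M p → ∀ x ∈ q :: l, 1 ≤ M x → False := by
      intro M hM hMp x hx hMx
      obtain ⟨M', h1, h2, y, hy, h3⟩ := S.move hpt hHp hP hdis hM hMp x hx hMx
      have h4 := ihP (S.step _ _ h1 h2)
      have h5 := sum_pos_of_mem hy h3
      have h6 := sum_fire_ge (M := M') (t := t) (l := l)
        (fun x hx => hdis x (List.mem_cons_of_mem _ hx))
      have h7 : M' q + 1 ≤ N.fire M' t q := fire_post_ge (hdis q (by simp)) hqt
      simp only [List.map_cons, List.sum_cons] at h4 h5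
      omega
    intro M hM
    by_contra hc
    rw [List.map_cons, List.sum_cons] at hc
    have h1 := ihP hM
    by_cases h2 : 1 ≤ ((q :: l).map M).sum
    · obtain ⟨x, hx, hMx⟩ := exists_of_sum_pos h2
      exact key hM (by omega) x hx hMx
    · obtain ⟨σ, hσ⟩ := S.home M hM
      obtain ⟨M', h3, h4, h5⟩ := S.wait hpt hHp (k := 2) (by omega) hM hσ (by omega)
      refine key (S.step _ _ h3 h4) ?_ q (by simp) (fire_post hqt)
      have : M' p ≤ N.fire M' t p + 1 := fire_pred
      omega

/-- Two marked places on a path, one being the head, are impossible. -/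
theorem Sit.path_two (S : Sit N R H) {p : P} {l : List P} (hl : DPath N H (p :: l))
    {M : P → ℕ} (hM : R M) (hMp : 1 ≤ M p) {x : P} (hx : x ∈ l) (hMx : 1 ≤ M x) : False := by
  have h1 := S.path_le_one hl hM
  have h2 := sum_pos_of_mem hx hMx
  simp only [List.map_cons, List.sum_cons] at h1
  omega

/-- Shortcut of a path at the last place of the cluster of `s`, keeping a given suffix. -/
theorem Sit.shortcut (S : Sit N R H) {p q : P} {s : T} {π : List P} (hp : p ∈ N.pre s)
    (hHp : H p = 0) (l : List P) : DPath N H (l ++ q :: π) → (∃ x ∈ l, x ∈ N.pre s) →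
    ∃ l', DPath N H (p :: (l' ++ q :: π)) := by
  induction l with
  | nil => rintro _ ⟨x, hx, _⟩; simp at hx
  | cons a l ih =>
    rintro hP hex
    by_cases hex' : ∃ x ∈ l, x ∈ N.pre s
    · refine ih ?_ hex'
      rw [List.cons_append] at hP
      generalize hL : l ++ q :: π = L at hP
      cases hP with
      | last _ => simp at hL
      | cons _ _ _ _ h => exact h
    · have ha : a ∈ N.pre s := by
        obtain ⟨x, hx, hxs⟩ := hex
        rcases List.mem_cons.1 hx with rfl | hx
        · exact hxs
        · exact absurd ⟨x, hx, hxs⟩ hex'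
      refine ⟨l, ?_⟩
      rw [List.cons_append] at hP
      generalize hL : l ++ q :: π = L at hP
      cases hP with
      | last _ => simp at hL
      | @cons _ t' b L' h1 h2 h3 h4 h5 =>
        have heq := S.fc t' s a h1 ha
        exact DPath.cons (t := t') (by rw [heq]; exact hp) h2 hHp h4 h5

theorem Sit.extend (S : Sit N R H) {p q : P} {s : T} {π : List P} (hp : p ∈ N.pre s)
    (hHp : H p = 0) (hdis : ∀ x ∈ q :: π, x ∉ N.pre s) {l : List P}
    (hP : DPath N H (l ++ q :: π)) {y : P} (hy : y ∈ N.post s)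
    (hhead : (l ++ q :: π).head? = some y) :
    ∃ l', DPath N H (p :: (l' ++ q :: π)) := by
  by_cases hex : ∃ x ∈ l, x ∈ N.pre s
  · exact S.shortcut hp hHp l hP hex
  · refine ⟨l, ?_⟩
    have hall : ∀ x ∈ l ++ q :: π, x ∉ N.pre s := by
      intro x hx
      rcases List.mem_append.1 hx with hx | hx
      · exact fun h => hex ⟨x, hx, h⟩
      · exact hdis x hx
    generalize hL : l ++ q :: π = L at *
    cases L with
    | nil => simp at hhead
    | cons z L =>
      simp only [List.head?_cons, Option.some.injEq] at hhead
      subst hhead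
      exact DPath.cons hp hy hHp hall hP

/-- Every marked place starts a disentangled path. -/
theorem Sit.path_exists (S : Sit N R H) {σ : List T} : ∀ {M : P → ℕ}, R M → N.Fires M σ H →
    ∀ p, 1 ≤ M p → ∃ l, DPath N H (p :: l) := by
  induction σ with
  | nil => intro M _ hF p hp; cases hF; exact ⟨[], DPath.last hp⟩
  | cons s σ ih =>
    intro M hM hF p hMp
    cases hF with
    | cons hs hF =>
    by_cases hps : p ∈ N.pre s
    · by_cases hHp : 1 ≤ H p
      · exact ⟨[], DPath.last hHp⟩
      obtain ⟨y, hy⟩ := (S.proper s).2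
      obtain ⟨l, hl⟩ := ih (S.step _ _ hM hs) hF y (fire_post hy)
      have hH0 : H p = 0 := by omega
      by_cases hex : ∃ x ∈ y :: l, x ∈ N.pre s
      · have gen : ∀ L : List P, DPath N H L → (∃ x ∈ L, x ∈ N.pre s) →
            ∃ l', DPath N H (p :: l') := by
          intro L hL
          induction hL with
          | @last q hq =>
            rintro ⟨x, hx, hxs⟩
            simp only [List.mem_singleton] at hx
            subst hx
            exact absurd ((S.cl.touch s x hxs hq p).2 hps) hHp
          | @cons a t' b l h1 h2 h3 h4 h5 ih5 =>
            rintro ⟨x, hx, hxs⟩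
            rcases List.mem_cons.1 hx with rfl | hx
            · have heq := S.fc t' s x h1 hxs
              exact ⟨_, DPath.cons (t := t') (by rw [heq]; exact hps) h2 hH0 h4 h5⟩
            · exact ih5 ⟨x, hx, hxs⟩
        exact gen _ hl hex
      · push Not at hex
        exact ⟨_, DPath.cons hps hy hH0 hex hl⟩
    · exact ih (S.step _ _ hM hs) hF p (le_trans hMp (fire_ge hps))

/-- There are no conflict pairs. -/
theorem Sit.no_conflict (S : Sit N R H) {M1 M2 : P → ℕ} (hM1 : R M1) (hM2 : R M2) {t1 : T}
    (ht1 : N.enabled M1 t1) (hn : ¬ N.enabled M2 t1) {p : P} (hp : p ∈ N.pre t1)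
    (hM2p : 1 ≤ M2 p) (hB : ∀ t, N.enabled M2 t → ∃ r ∈ N.pre t, 1 ≤ M1 r) : False := by
  obtain ⟨σ, hσ⟩ := S.home M2 hM2
  -- the common continuation of all places of the cluster
  obtain ⟨π, hπ⟩ : ∃ π, ∀ q ∈ N.pre t1, DPath N H (q :: π) := by
    by_cases hHp : 1 ≤ H p
    · exact ⟨[], fun q hq => DPath.last ((S.cl.touch t1 p hp hHp q).2 hq)⟩
    · obtain ⟨l, hl⟩ := S.path_exists hM2 hσ p hM2p
      refine ⟨l, fun q hq => ?_⟩
      have hHq : H q = 0 := by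
        by_contra h
        exact hHp ((S.cl.touch t1 q hq (by omega) p).2 hp)
      cases hl with
      | last h => exact absurd h hHp
      | @cons _ t' b L h1 h2 h3 h4 h5 =>
        have heq := S.fc t' t1 p h1 hp
        exact DPath.cons (t := t') (by rw [heq]; exact hq) h2 hHq h4 h5
  obtain ⟨q, hq, hM2q⟩ : ∃ q ∈ N.pre t1, M2 q = 0 := by
    by_contra hc
    push Not at hc
    exact hn (fun q hq => Nat.one_le_iff_ne_zero.2 (hc q hq))
  have hfin : ∀ r l', 1 ≤ M1 r → DPath N H (r :: (l' ++ q :: π)) → False := by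
    intro r l' hr hP
    exact S.path_two hP hM1 hr (x := q) (by simp) (ht1 q hq)
  -- `V x`: no path from `x` through `q`
  have main : ∀ (σ : List T) (M : P → ℕ), R M → N.Fires M σ H → 1 ≤ M p →
      (∀ x, 1 ≤ M x → 1 ≤ M2 x ∨ ∀ l, (l ++ q :: π).head? = some x →
        DPath N H (l ++ q :: π) → False) → False := by
    intro σ
    induction σ with
    | nil =>
      intro M hM hF hMp hV
      cases hF
      have hHq := (S.cl.touch t1 p hp hMp q).2 hq
      rcases hV q hHq with h | h
      · omega
      · exact h [] (by simp) (hπ q hq)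
    | cons s σ ih =>
      intro M hM hF hMp hV
      cases hF with
      | cons hs hF =>
      by_cases hst : N.pre s = N.pre t1
      · rcases hV q (hs q (by rw [hst]; exact hq)) with h | h
        · omega
        · exact h [] (by simp) (hπ q hq)
      have hps : p ∉ N.pre s := fun h => hst (S.fc s t1 p h hp)
      have hdis : ∀ x ∈ q :: π, x ∉ N.pre s := by
        intro x hx hxs
        rcases List.mem_cons.1 hx with rfl | hx
        · exact hst (S.fc s t1 x hxs hq)
        · exact S.path_two (hπ p hp) hM hMp hx (hs x hxs)
      have hH0 : ∀ z ∈ N.pre s, H z = 0 := by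
        intro z hz
        by_contra h
        have heq := S.eq_of_touch hM hs hz (by omega)
        rw [heq] at hMp
        exact hps ((S.cl.touch s z hz (by omega) p).1 hMp)
      refine ih _ (S.step _ _ hM hs) hF (le_trans hMp (fire_ge hps)) ?_
      intro x hx
      rcases fire_new hx with hx | hx
      · exact hV x hx
      right
      intro l hhead hP
      by_cases hs2 : N.enabled M2 s
      · obtain ⟨r, hr, hM1r⟩ := hB s hs2
        obtain ⟨l', hl'⟩ := S.extend hr (hH0 r hr) hdis hP hx hhead
        exact hfin r l' hM1r hl'
      · obtain ⟨z, hz, hM2z⟩ : ∃ z ∈ N.pre s, M2 z = 0 := by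
          by_contra hc
          push Not at hc
          exact hs2 (fun q hq => Nat.one_le_iff_ne_zero.2 (hc q hq))
        obtain ⟨l', hl'⟩ := S.extend hz (hH0 z hz) hdis hP hx hhead
        rcases hV z (hs z hz) with h | h
        · omega
        · exact h (z :: l') (by simp) (by simpa using hl')
  exact main σ M2 hM2 hσ hM2p (fun x hx => Or.inl hx)

theorem Sit.safe (S : Sit N R H) {M : P → ℕ} (hM : R M) (p : P) : M p ≤ 1 := by
  by_contra hc
  obtain ⟨σ, hσ⟩ := S.home M hM
  obtain ⟨l, hl⟩ := S.path_exists hM hσ p (by omega)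
  have := S.path_le_one hl hM
  simp only [List.map_cons, List.sum_cons] at this
  omega

/-- Partial overlap of enabled transitions, from equal enabled sets of the origin. -/
theorem Sit.overlap (S : Sit N R H) {M1 M2 A1 A2 : P → ℕ} (hM1 : R M1)
    (hen : N.en M1 = N.en M2) (hd : A1 + M2 = A2 + M1) {t : T} (ht : N.enabled A1 t) :
    ∃ r ∈ N.pre t, 1 ≤ A2 r := by
  by_contra hc
  push Not at hc
  have h1 : N.enabled M1 t := by
    intro p hp
    have h1 := ht p hp
    have h2 := hc p hp
    have h3 := congrFun hd p
    simp only [Pi.add_apply] at h3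
    omega
  have h2 : N.enabled M2 t := by
    have : t ∈ N.en M1 := h1
    rw [hen] at this
    exact this
  obtain ⟨p, hp⟩ := (S.proper t).1
  have h3 := congrFun hd p
  have h4 := S.safe hM1 p
  have h5 := h2 p hp
  have h6 := ht p hp
  have h7 := hc p hp
  simp only [Pi.add_apply] at h3
  omega

theorem Sit.lucent (S : Sit N R H) {M1 M2 : P → ℕ} (hM1 : R M1) (hM2 : R M2)
    (hen : N.en M1 = N.en M2) : M1 = M2 := by
  have main : ∀ (n : ℕ) (A1 A2 : P → ℕ) (σ : List T), σ.length = n → R A1 → R A2 →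
      N.Fires A1 σ H → A1 + M2 = A2 + M1 → A1 = A2 := by
    intro n
    induction n using Nat.strong_induction_on with
    | _ n ih =>
    intro A1 A2 σ hn hA1 hA2 hF hd
    by_cases hcom : ∃ t, N.enabled A1 t ∧ N.enabled A2 t
    · obtain ⟨u, hu1, hu2⟩ := hcom
      by_cases hex : ∃ t ∈ σ, N.pre t = N.pre u
      · obtain ⟨t, σ', htu, hF', hl⟩ := expedite_s13 S.fc hu1 hF hex
        have ht1 : N.enabled A1 t := by
          intro p hp; rw [htu] at hp; exact hu1 p hp
        have ht2 : N.enabled A2 t := by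
          intro p hp; rw [htu] at hp; exact hu2 p hp
        have hd' : N.fire A1 t + M2 = N.fire A2 t + M1 := by
          rw [← fire_add ht1, ← fire_add ht2, hd]
        have hfin := ih _ (by omega) _ _ σ' rfl (S.step _ _ hA1 ht1) (S.step _ _ hA2 ht2) hF' hd'
        rw [hfin] at hd'
        have hMM : M2 = M1 := add_left_cancel hd'
        rw [hMM] at hd
        exact add_right_cancel hd
      · have huH := persist S.fc hu1 hF hex
        obtain ⟨x, hx⟩ := (S.proper u).1
        rw [S.eq_of_touch hA1 hu1 hx (huH x hx), S.eq_of_touch hA2 hu2 hx (huH x hx)]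
    · push Not at hcom
      have o1 : ∀ t, N.enabled A1 t → ∃ r ∈ N.pre t, 1 ≤ A2 r :=
        fun t ht => S.overlap hM1 hen hd ht
      have o2 : ∀ t, N.enabled A2 t → ∃ r ∈ N.pre t, 1 ≤ A1 r :=
        fun t ht => S.overlap hM2 hen.symm hd.symm ht
      have d1 : ∀ t, ¬ N.enabled A1 t := by
        intro t ht
        obtain ⟨r, hr, h⟩ := o1 t ht
        exact S.no_conflict hA1 hA2 ht (hcom t ht) hr h o2
      have d2 : ∀ t, ¬ N.enabled A2 t := by
        intro t ht
        obtain ⟨r, hr, h⟩ := o2 t ht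
        exact S.no_conflict hA2 hA1 ht (d1 t) hr h o1
      obtain ⟨τ, hτ⟩ := S.home A2 hA2
      cases hF with
      | cons hs _ => exact absurd hs (d1 _)
      | nil =>
        cases hτ with
        | cons hs _ => exact absurd hs (d2 _)
        | nil => rfl
  obtain ⟨σ, hσ⟩ := S.home M1 hM1
  exact main _ M1 M2 σ rfl hM1 hM2 hσ (add_comm _ _)

theorem cluster_inl (hf : FC N) {a : P} {y : P ⊕ T} (h : N.InCluster (Sum.inl a) y) :
    (∀ b, y = Sum.inl b → b = a ∨ ∃ t, a ∈ N.pre t ∧ b ∈ N.pre t) ∧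
    (∀ t, y = Sum.inr t → a ∈ N.pre t) := by
  induction h with
  | refl => simp
  | @toTrans p t _ hp ih =>
    refine ⟨by simp, ?_⟩
    intro t' ht'
    cases ht'
    rcases ih.1 p rfl with rfl | ⟨t', h1, h2⟩
    · exact hp
    · rw [← hf t' t p h2 hp]; exact h1
  | @toPlace t p _ hp ih =>
    refine ⟨?_, by simp⟩
    intro b hb
    cases hb
    exact Or.inr ⟨t, ih.2 t rfl, hp⟩

theorem cluster_inr (hf : FC N) {s : T} {y : P ⊕ T} (h : N.InCluster (Sum.inr s) y) :
    (∀ b, y = Sum.inl b → b ∈ N.pre s) ∧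
    (∀ t, y = Sum.inr t → N.pre t = N.pre s) := by
  induction h with
  | refl => simp
  | @toTrans p t _ hp ih =>
    refine ⟨by simp, ?_⟩
    intro t' ht'
    cases ht'
    exact hf t s p hp (ih.1 p rfl)
  | @toPlace t p _ hp ih =>
    refine ⟨?_, by simp⟩
    intro b hb
    cases hb
    rw [← ih.2 t rfl]
    exact hp

theorem clMark_of_cluster (hf : FC N) {C : Set (P ⊕ T)} (hC : N.IsCluster C) :
    ClMark N (clusterMrk C) := by
  have hpos : ∀ p, 1 ≤ clusterMrk C p ↔ Sum.inl p ∈ C := by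
    intro p
    unfold clusterMrk
    split_ifs with h <;> simp [h]
  refine ⟨?_, ?_⟩
  · intro p
    unfold clusterMrk
    split_ifs <;> simp
  · intro t p hp h1 q
    rw [hpos] at h1 ⊢
    obtain ⟨x, rfl⟩ := hC
    constructor
    · intro h2
      cases x with
      | inl a =>
        have ht : N.InCluster (Sum.inl a) (Sum.inr t) := InCluster.toTrans h1 hp
        have ha := (cluster_inl hf ht).2 t rfl
        rcases (cluster_inl hf h2).1 q rfl with rfl | ⟨t', h3, h4⟩
        · exact ha
        · rw [hf t t' a ha h3]; exact h4
      | inr s =>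
        rw [hf t s p hp ((cluster_inr hf h1).1 p rfl)]
        exact (cluster_inr hf h2).1 q rfl
    · intro hq
      exact InCluster.toPlace (InCluster.toTrans h1 hp) hq

end Helpers

end PetriNet

/-- Every marked proper free-choice net having a home cluster is
lucent. -/
theorem home_cluster_implies_lucent {P T : Type} [DecidableEq P]
    (N : PetriNet P T) (M : P → ℕ) (C : Set (P ⊕ T))
    (hp : N.Proper) (hfc : N.FreeChoice) (hc : N.HomeCluster M C) :
    N.Lucent M := by
  obtain ⟨hC, hhome⟩ := hc
  have hf := PetriNet.FreeChoice.fc hfc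
  have hcl := PetriNet.clMark_of_cluster hf hC
  have hMH := hhome M (PetriNet.Reach.refl M)
  have hHH : ∀ M', N.Reach (PetriNet.clusterMrk C) M' → N.Reach M' (PetriNet.clusterMrk C) :=
    fun M' h => hhome M' (hMH.trans h)
  have S : PetriNet.Sit N (N.Reach M) (PetriNet.clusterMrk C) := by
    refine ⟨hp, hf, hcl, fun M' t h ht => h.fire ht, hhome, ?_⟩
    intro M' hM' hle
    obtain ⟨σ, hσ⟩ := hhome M' hM'
    have heq : M' = PetriNet.clusterMrk C + (M' - PetriNet.clusterMrk C) := by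
      funext q
      have := hle q
      simp only [Pi.add_apply, Pi.sub_apply]
      omega
    rw [heq] at hσ
    have h0 := PetriNet.above_home hp hf hcl hHH _ _ σ rfl hσ
    rw [heq, h0, add_zero]
  intro M1 M2 h1 h2 hen
  exact S.lucent h1 h2 hen
end
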